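/- Let ν > n/2 − 1, 1 ≤ p < ∞ with conjugate exponent p', and m ≥ 1 an integer. There exists a constant c_{ν,m} such that for all F ∈ A^p_ν and all G ∈ A^{p'}_ν (where for p = 1 one takes G a bounded holomorphic function on T_Λ): ∫_{T_Λ} F(z) \overline{G(z)} dV_ν(z) = c_{ν,m} ∫_{T_Λ} F(z) \overline{□^m G(z)} Δ(Im z)^m dV_ν(z), both integrals being absolutely convergent. -/

import Mathlib

open MeasureTheory Complex Set
open scoped ENNReal

noncomputable section

/-- The Lorentz form `Δ(y) = y₁² − y₂² − ⋯ − yₙ²` on `ℝⁿ`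
(written as `2 y₀² − ∑ yᵢ²` with 0-based indexing). -/
def lor {n : ℕ} [NeZero n] (y : Fin n → ℝ) : ℝ := 2 * y 0 ^ 2 - ∑ i, y i ^ 2

/-- The holomorphic extension of the Lorentz form to `ℂⁿ`. -/
def lorC {n : ℕ} [NeZero n] (z : Fin n → ℂ) : ℂ := 2 * z 0 ^ 2 - ∑ i, z i ^ 2

/-- Componentwise imaginary part. -/
def imP {n : ℕ} (z : Fin n → ℂ) : Fin n → ℝ := fun i => (z i).im

/-- The forward light cone `Λ`. -/
def cone (n : ℕ) [NeZero n] : Set (Fin n → ℝ) := {y | 0 < lor y ∧ 0 < y 0}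

/-- The tube domain `T_Λ` over the forward light cone. -/
def tube (n : ℕ) [NeZero n] : Set (Fin n → ℂ) := {z | imP z ∈ cone n}

/-- The weighted measure `dV_ν = Δ(Im z)^{ν − n/2} dz` on `T_Λ`. -/
def dV (n : ℕ) [NeZero n] (ν : ℝ) : Measure (Fin n → ℂ) :=
  ((volume : Measure (Fin n → ℂ)).restrict (tube n)).withDensity
    (fun z => ENNReal.ofReal (lor (imP z) ^ (ν - (n : ℝ) / 2)))

/-- `∫ |F|^p dV_ν` (as an extended nonnegative real). -/
def lpInt (n : ℕ) [NeZero n] (p ν : ℝ) (F : (Fin n → ℂ) → ℂ) : ℝ≥0∞ :=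
  ∫⁻ z, ENNReal.ofReal (‖F z‖ ^ p) ∂(dV n ν)

/-- The `L^p_ν` norm `(∫ |F|^p dV_ν)^{1/p}`. -/
def lpNorm (n : ℕ) [NeZero n] (p ν : ℝ) (F : (Fin n → ℂ) → ℂ) : ℝ≥0∞ :=
  (lpInt n p ν F) ^ (1 / p)

/-- The Bergman space `A^p_ν`: holomorphic on `T_Λ` and in `L^p_ν`. -/
def memA (n : ℕ) [NeZero n] (p ν : ℝ) (F : (Fin n → ℂ) → ℂ) : Prop :=
  DifferentiableOn ℂ F (tube n) ∧ lpInt n p ν F < ⊤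

/-- Partial derivative `∂/∂zᵢ`. -/
def pd {n : ℕ} (i : Fin n) (F : (Fin n → ℂ) → ℂ) : (Fin n → ℂ) → ℂ :=
  fun z => fderiv ℂ F z (Pi.single i 1)

/-- The wave (Box) operator `□ = −(∂₁² − ∂₂² − ⋯ − ∂ₙ²)`, so that
`□ e^{i z·ξ} = Δ(ξ) e^{i z·ξ}`. -/
def BoxOp {n : ℕ} [NeZero n] (F : (Fin n → ℂ) → ℂ) : (Fin n → ℂ) → ℂ :=
  fun z => -(2 * pd 0 (pd 0 F) z - ∑ i, pd i (pd i F) z)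

/-- The (unnormalized) Bergman kernel `B_β(z,w) = Δ((z − w̄)/i)^{−(β+n)}`. -/
def berg (n : ℕ) [NeZero n] (β : ℝ) (z w : Fin n → ℂ) : ℂ :=
  lorC (fun i => (z i - (starRingEnd ℂ) (w i)) / Complex.I) ^ (-(β + (n : ℝ)) : ℂ)

/-- The Hardy inequality holds for `(p, ν)`:
`∫ |F|^p dV_ν ≤ C ∫ |Δ(Im z) □F(z)|^p dV_ν(z)` for all `F ∈ A^p_ν`. -/
def hardy (n : ℕ) [NeZero n] (p ν : ℝ) : Prop :=
  ∃ C > (0 : ℝ), ∀ F, memA n p ν F →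
    lpInt n p ν F ≤ ENNReal.ofReal C *
      lpInt n p ν (fun z => (lor (imP z) : ℂ) * BoxOp F z)

/-- `g` is the orthogonal projection of `f ∈ L²_ν` onto the closed subspace `A²_ν`:
`g ∈ A²_ν` and `f − g ⊥ A²_ν`. -/
def isProj (n : ℕ) [NeZero n] (ν : ℝ) (f g : (Fin n → ℂ) → ℂ) : Prop :=
  memA n 2 ν g ∧ ∀ h, memA n 2 ν h →
    ∫ z, f z * (starRingEnd ℂ) (h z) ∂(dV n ν) =
      ∫ z, g z * (starRingEnd ℂ) (h z) ∂(dV n ν)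

/-- The Bergman projection `P_ν` admits a bounded extension to `L^p_ν`:
`‖P_ν f‖_{L^p_ν} ≤ C ‖f‖_{L^p_ν}` for all `f ∈ L²_ν ∩ L^p_ν`. -/
def projBounded (n : ℕ) [NeZero n] (p ν : ℝ) : Prop :=
  ∃ C > (0 : ℝ), ∀ f g : (Fin n → ℂ) → ℂ,
    AEStronglyMeasurable f (dV n ν) → lpInt n 2 ν f < ⊤ → lpInt n p ν f < ⊤ →
    isProj n ν f g → lpNorm n p ν g ≤ ENNReal.ofReal C * lpNorm n p ν f

/-- A bounded (continuous) linear functional on `A^p_ν`. -/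
def isBddFunc (n : ℕ) [NeZero n] (p ν : ℝ) (γ : ((Fin n → ℂ) → ℂ) → ℂ) : Prop :=
  (∀ F G, memA n p ν F → memA n p ν G → γ (F + G) = γ F + γ G) ∧
  (∀ (c : ℂ) (F), memA n p ν F → γ (fun z => c * F z) = c * γ F) ∧
  ∃ C : ℝ, ∀ F, memA n p ν F → ‖γ F‖ ≤ C * (lpNorm n p ν F).toReal

/-! ### Geometry of the Lorentz cone -/

/-- The bilinear form polarising `lor`. -/
def lorBil {n : ℕ} [NeZero n] (u v : Fin n → ℝ) : ℝ := 2 * (u 0 * v 0) - ∑ i, u i * v i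

/-- The complex bilinear form polarising `lorC`. -/
def lorBilC {n : ℕ} [NeZero n] (u v : Fin n → ℂ) : ℂ := 2 * (u 0 * v 0) - ∑ i, u i * v i

/-- Componentwise real part. -/
def reP {n : ℕ} (z : Fin n → ℂ) : Fin n → ℝ := fun i => (z i).re

section Geometry

variable {n : ℕ} [NeZero n]

lemma lor_eq_lorBil (u : Fin n → ℝ) : lor u = lorBil u u := by
  simp [lor, lorBil, sq]

lemma lorC_eq_lorBilC (u : Fin n → ℂ) : lorC u = lorBilC u u := by
  simp [lorC, lorBilC, sq]

lemma lorBil_comm (u v : Fin n → ℝ) : lorBil u v = lorBil v u := by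
  simp [lorBil, mul_comm]

lemma lorBil_add_left (u v w : Fin n → ℝ) : lorBil (u + v) w = lorBil u w + lorBil v w := by
  simp only [lorBil, Pi.add_apply, add_mul, Finset.sum_add_distrib]; ring

lemma lorBil_smul_left (t : ℝ) (u w : Fin n → ℝ) : lorBil (t • u) w = t * lorBil u w := by
  simp only [lorBil, Pi.smul_apply, smul_eq_mul, mul_assoc, ← Finset.mul_sum]; ring

lemma lorBil_add_right (w u v : Fin n → ℝ) : lorBil w (u + v) = lorBil w u + lorBil w v := by
  rw [lorBil_comm, lorBil_add_left, lorBil_comm u, lorBil_comm v]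

lemma lorBil_smul_right (t : ℝ) (w u : Fin n → ℝ) : lorBil w (t • u) = t * lorBil w u := by
  rw [lorBil_comm, lorBil_smul_left, lorBil_comm u]

lemma lorBil_neg_right (w u : Fin n → ℝ) : lorBil w (-u) = -lorBil w u := by
  rw [← neg_one_smul ℝ u, lorBil_smul_right]; ring

lemma lorBilC_comm (u v : Fin n → ℂ) : lorBilC u v = lorBilC v u := by
  simp [lorBilC, mul_comm]

lemma lorBilC_add_left (u v w : Fin n → ℂ) : lorBilC (u + v) w = lorBilC u w + lorBilC v w := by
  simp only [lorBilC, Pi.add_apply, add_mul, Finset.sum_add_distrib]; ring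

lemma lorBilC_smul_left (t : ℂ) (u w : Fin n → ℂ) : lorBilC (t • u) w = t * lorBilC u w := by
  simp only [lorBilC, Pi.smul_apply, smul_eq_mul, mul_assoc, ← Finset.mul_sum]; ring

lemma lor_add (u v : Fin n → ℝ) : lor (u + v) = lor u + lor v + 2 * lorBil u v := by
  simp only [lor_eq_lorBil, lorBil_add_left, lorBil_add_right, lorBil_comm v u]; ring

lemma lor_smul (t : ℝ) (u : Fin n → ℝ) : lor (t • u) = t ^ 2 * lor u := by
  simp only [lor_eq_lorBil, lorBil_smul_left, lorBil_smul_right]; ring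

lemma lor_neg (u : Fin n → ℝ) : lor (-u) = lor u := by
  simp [lor]

lemma lorC_add (u v : Fin n → ℂ) : lorC (u + v) = lorC u + lorC v + 2 * lorBilC u v := by
  simp only [lorC_eq_lorBilC, lorBilC_add_left, lorBilC_comm _ (u + v), lorBilC_comm v u]; ring

lemma lorC_smul (t : ℂ) (u : Fin n → ℂ) : lorC (t • u) = t ^ 2 * lorC u := by
  simp only [lorC_eq_lorBilC, lorBilC_smul_left, lorBilC_comm _ (t • u)]; ring

lemma sum_sub_zero (f : Fin n → ℝ) : ∑ i, f i - f 0 = ∑ i ∈ Finset.univ.erase 0, f i := by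
  rw [← Finset.add_sum_erase _ _ (Finset.mem_univ (0 : Fin n))]; ring

lemma tail_nonneg (u : Fin n → ℝ) : 0 ≤ ∑ i, u i ^ 2 - u 0 ^ 2 := by
  rw [sum_sub_zero (fun i => u i ^ 2)]
  exact Finset.sum_nonneg fun i _ => sq_nonneg _

lemma tail_cauchy_schwarz (u v : Fin n → ℝ) :
    (∑ i, u i * v i - u 0 * v 0) ^ 2 ≤
      (∑ i, u i ^ 2 - u 0 ^ 2) * (∑ i, v i ^ 2 - v 0 ^ 2) := by
  rw [sum_sub_zero (fun i => u i ^ 2), sum_sub_zero (fun i => v i ^ 2),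
    sum_sub_zero (fun i => u i * v i)]
  exact Finset.sum_mul_sq_le_sq_mul_sq _ _ _

lemma lorBil_pos {u v : Fin n → ℝ} (hu : u ∈ cone n) (hv : v ∈ cone n) : 0 < lorBil u v := by
  obtain ⟨hu1, hu0⟩ := hu
  obtain ⟨hv1, hv0⟩ := hv
  have h := tail_cauchy_schwarz u v
  have hu2 := tail_nonneg u
  have hv2 := tail_nonneg v
  unfold lor at hu1 hv1
  unfold lorBil
  have h1 : (∑ i, u i * v i - u 0 * v 0) ^ 2 < (u 0 * v 0) ^ 2 := by
    refine h.trans_lt ?_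
    rw [mul_pow]
    exact mul_lt_mul'' (by linarith) (by linarith) hu2 hv2
  have := abs_lt_of_sq_lt_sq h1 (by positivity)
  have := (abs_lt.1 this).2
  linarith

lemma add_mem_cone {u v : Fin n → ℝ} (hu : u ∈ cone n) (hv : v ∈ cone n) : u + v ∈ cone n := by
  refine ⟨?_, add_pos hu.2 hv.2⟩
  rw [lor_add]
  have := lorBil_pos hu hv
  linarith [hu.1, hv.1]

lemma smul_mem_cone {t : ℝ} (ht : 0 < t) {u : Fin n → ℝ} (hu : u ∈ cone n) : t • u ∈ cone n := by
  refine ⟨?_, mul_pos ht hu.2⟩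
  rw [lor_smul]
  have := hu.1
  positivity

lemma lor_le_lor_add {u v : Fin n → ℝ} (hu : u ∈ cone n) (hv : v ∈ cone n) :
    lor u ≤ lor (u + v) := by
  rw [lor_add]
  have := lorBil_pos hu hv
  linarith [hv.1]

lemma lor_le_of_sub_mem {u v : Fin n → ℝ} (hu : u ∈ cone n) (hv : v - u ∈ cone n) :
    lor u ≤ lor v := by
  simpa using lor_le_lor_add hu hv

lemma mem_cone_or_neg {v : Fin n → ℝ} (hv : 0 < lor v) : v ∈ cone n ∨ -v ∈ cone n := by
  have h0 : v 0 ≠ 0 := by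
    intro h
    have := tail_nonneg v
    unfold lor at hv
    rw [h] at this hv
    linarith
  rcases lt_or_gt_of_ne h0 with h | h
  · exact Or.inr ⟨by rwa [lor_neg], by simpa using h⟩
  · exact Or.inl ⟨hv, h⟩

lemma mem_cone_of_lorBil_pos {u v : Fin n → ℝ} (hu : u ∈ cone n) (hv : 0 < lor v)
    (huv : 0 < lorBil u v) : v ∈ cone n := by
  rcases mem_cone_or_neg hv with h | h
  · exact h
  · have := lorBil_pos hu h
    rw [lorBil_neg_right] at this
    linarith

lemma continuous_lor : Continuous (lor : (Fin n → ℝ) → ℝ) := by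
  unfold lor; fun_prop

lemma continuous_lorC : Continuous (lorC : (Fin n → ℂ) → ℂ) := by
  unfold lorC; fun_prop

lemma continuous_imP : Continuous (imP : (Fin n → ℂ) → Fin n → ℝ) := by
  unfold imP; fun_prop

lemma continuous_reP : Continuous (reP : (Fin n → ℂ) → Fin n → ℝ) := by
  unfold reP; fun_prop

lemma isOpen_cone : IsOpen (cone n) :=
  (isOpen_lt continuous_const continuous_lor).inter
    (isOpen_lt continuous_const (continuous_apply 0))

lemma isOpen_tube : IsOpen (tube n) := isOpen_cone.preimage continuous_imP

lemma imP_add (z w : Fin n → ℂ) : imP (z + w) = imP z + imP w := by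
  ext; simp [imP]

lemma imP_sub (z w : Fin n → ℂ) : imP (z - w) = imP z - imP w := by
  ext; simp [imP]

lemma reP_add (z w : Fin n → ℂ) : reP (z + w) = reP z + reP w := by
  ext; simp [reP]

lemma reP_sub (z w : Fin n → ℂ) : reP (z - w) = reP z - reP w := by
  ext; simp [reP]

lemma lorC_re (z : Fin n → ℂ) : (lorC z).re = lor (reP z) - lor (imP z) := by
  simp only [lorC, lor, reP, imP, sub_re, re_sum, sq, mul_re, re_ofNat, im_ofNat,
    Finset.sum_sub_distrib]
  ring

lemma lorC_im (z : Fin n → ℂ) : (lorC z).im = 2 * lorBil (reP z) (imP z) := by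
  simp only [lorC, lorBil, reP, imP, sub_im, im_sum, sq, mul_im, mul_re, re_ofNat, im_ofNat,
    Finset.sum_add_distrib]
  simp only [mul_comm (z _).im]
  ring

lemma lorC_ne_zero {z : Fin n → ℂ} (hz : z ∈ tube n) : lorC z ≠ 0 := by
  intro h
  have h1 := lorC_re z
  have h2 := lorC_im z
  rw [h] at h1 h2
  simp only [zero_re, zero_im] at h1 h2
  have hy : imP z ∈ cone n := hz
  have hx : 0 < lor (reP z) := by linarith [hy.1]
  rcases mem_cone_or_neg hx with hx | hx
  · linarith [lorBil_pos hx hy]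
  · have := lorBil_pos hy hx
    rw [lorBil_neg_right, lorBil_comm] at this
    linarith

/-- The base point of the cone. -/
def baseE (n : ℕ) [NeZero n] : Fin n → ℝ := Pi.single 0 1

lemma lorBil_baseE (v : Fin n → ℝ) : lorBil (baseE n) v = v 0 := by
  simp [lorBil, baseE, Pi.single_apply]; ring

lemma lor_baseE : lor (baseE n) = 1 := by
  rw [lor_eq_lorBil, lorBil_baseE]; simp [baseE]

lemma baseE_mem : baseE n ∈ cone n := ⟨by rw [lor_baseE]; norm_num, by simp [baseE]⟩

/-- The complexification of a real vector. -/
def toC (v : Fin n → ℝ) : Fin n → ℂ := fun i => (v i : ℂ)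

lemma imP_add_smul_toC (z : Fin n → ℂ) (l : ℂ) (y : Fin n → ℝ) :
    imP (z + l • toC y) = imP z + l.im • y := by
  ext; simp [imP, toC]

lemma lorC_toC (y : Fin n → ℝ) : lorC (toC y) = (lor y : ℂ) := by
  simp [lorC, lor, toC]

lemma quadratic_root_bounds {A : ℝ} (hA : 0 < A) {B C : ℂ}
    (h : ∀ l : ℂ, A * l ^ 2 + 2 * B * l + C = 0 → 1 ≤ ‖l‖) : A ≤ ‖C‖ ∧ ‖B‖ ≤ ‖C‖ := by
  obtain ⟨s, hs⟩ := IsAlgClosed.exists_pow_nat_eq (B ^ 2 - A * C) (n := 2) zero_lt_two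
  have hA' : (A : ℂ) ≠ 0 := by exact_mod_cast hA.ne'
  set l₁ : ℂ := (-B + s) / A with hl₁
  set l₂ : ℂ := (-B - s) / A with hl₂
  have h₁ : 1 ≤ ‖l₁‖ := h _ (by rw [hl₁]; field_simp; linear_combination hs)
  have h₂ : 1 ≤ ‖l₂‖ := h _ (by rw [hl₂]; field_simp; linear_combination hs)
  have hC : C = A * (l₁ * l₂) := by rw [hl₁, hl₂]; field_simp; linear_combination hs
  have hB : 2 * B = -(A * (l₁ + l₂)) := by rw [hl₁, hl₂]; field_simp; ring
  have hCn : ‖C‖ = A * (‖l₁‖ * ‖l₂‖) := by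
    rw [hC, norm_mul, norm_mul, norm_real, Real.norm_of_nonneg hA.le]
  have hBn : 2 * ‖B‖ ≤ A * (‖l₁‖ + ‖l₂‖) := by
    have : ‖2 * B‖ = A * ‖l₁ + l₂‖ := by
      rw [hB, norm_neg, norm_mul, norm_real, Real.norm_of_nonneg hA.le]
    rw [norm_mul, norm_ofNat] at this
    rw [this]
    gcongr
    exact norm_add_le _ _
  constructor
  · rw [hCn]
    nlinarith [mul_nonneg (sub_nonneg.2 h₁) (sub_nonneg.2 h₂)]
  · rw [hCn]
    nlinarith [mul_nonneg (sub_nonneg.2 h₁) (norm_nonneg l₂),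
      mul_nonneg (sub_nonneg.2 h₂) (norm_nonneg l₁),
      mul_le_mul_of_nonneg_left (show ‖l₁‖ + ‖l₂‖ ≤ 2 * (‖l₁‖ * ‖l₂‖) by nlinarith) hA.le]

/-- If `z + l y` stays in the tube for all `l` with `Im l > -1`, then `Δ(y)` and the polar form of
`z` and `y` are controlled by `Δ(z)`. -/
lemma lor_le_norm_lorC {y : Fin n → ℝ} {z : Fin n → ℂ} (hy : y ∈ cone n)
    (h : ∀ t : ℝ, -1 < t → imP z + t • y ∈ cone n) :
    lor y ≤ ‖lorC z‖ ∧ ‖lorBilC z (toC y)‖ ≤ ‖lorC z‖ := by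
  refine quadratic_root_bounds hy.1 fun l hl => ?_
  by_contra hlt
  rw [not_le] at hlt
  have him : -1 < l.im := by
    have := abs_im_le_norm l
    linarith [(abs_le.1 this).1]
  have hmem : z + l • toC y ∈ tube n := by
    change imP _ ∈ cone n
    rw [imP_add_smul_toC]
    exact h _ him
  refine lorC_ne_zero hmem ?_
  rw [lorC_add, lorC_smul, lorC_toC, lorBilC_comm, lorBilC_smul_left, lorBilC_comm (toC y)]
  linear_combination hl

end Geometry

/-! ### Lorentz boosts -/

section Boost

variable {n : ℕ} [NeZero n]

/-- The auxiliary vector `y + √Δ(y) e` used to define the boost. -/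
def boostVec (y : Fin n → ℝ) : Fin n → ℝ := y + √(lor y) • baseE n

/-- A conformal linear map of the Lorentz form, with factor `Δ(y)`, exchanging (up to scaling) the
base point and `y`. -/
def boost (y v : Fin n → ℝ) : Fin n → ℝ :=
  (lorBil v (boostVec y) / (√(lor y) + y 0)) • boostVec y - √(lor y) • v

/-- The complexification of `boost y`. -/
def boostC (y : Fin n → ℝ) : (Fin n → ℂ) →ₗ[ℂ] (Fin n → ℂ) where
  toFun w := (lorBilC w (toC (boostVec y)) / (√(lor y) + y 0 : ℝ)) • toC (boostVec y)
    - (√(lor y) : ℂ) • w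
  map_add' u v := by rw [lorBilC_add_left, add_div, add_smul, smul_add]; abel
  map_smul' t u := by
    rw [lorBilC_smul_left, RingHom.id_apply, smul_sub, smul_smul, smul_smul, smul_smul, mul_div_assoc,
      mul_comm (√(lor y) : ℂ)]

lemma sqrt_add_pos {y : Fin n → ℝ} (hy : y ∈ cone n) : 0 < √(lor y) + y 0 :=
  add_pos (Real.sqrt_pos.2 hy.1) hy.2

lemma lorBil_sub_left (u v w : Fin n → ℝ) : lorBil (u - v) w = lorBil u w - lorBil v w := by
  simp only [lorBil, Pi.sub_apply, sub_mul, Finset.sum_sub_distrib]; ring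

lemma lorBil_sub_right (w u v : Fin n → ℝ) : lorBil w (u - v) = lorBil w u - lorBil w v := by
  rw [lorBil_comm, lorBil_sub_left, lorBil_comm u, lorBil_comm v]

lemma lor_boostVec {y : Fin n → ℝ} (hy : y ∈ cone n) :
    lor (boostVec y) = 2 * √(lor y) * (√(lor y) + y 0) := by
  have h := Real.sq_sqrt hy.1.le
  rw [boostVec, lor_add, lor_smul, lor_baseE, lorBil_smul_right, lorBil_comm, lorBil_baseE]
  linear_combination -h

lemma lorBil_baseE_boostVec (y : Fin n → ℝ) :
    lorBil (baseE n) (boostVec y) = √(lor y) + y 0 := by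
  rw [lorBil_baseE]; simp [boostVec, baseE]; ring

lemma boost_baseE {y : Fin n → ℝ} (hy : y ∈ cone n) : boost y (baseE n) = y := by
  rw [boost, lorBil_baseE_boostVec, div_self (sqrt_add_pos hy).ne', one_smul, boostVec]
  abel

lemma lorBil_boost_boostVec {y : Fin n → ℝ} (hy : y ∈ cone n) (v : Fin n → ℝ) :
    lorBil (boost y v) (boostVec y) = √(lor y) * lorBil v (boostVec y) := by
  have := (sqrt_add_pos hy).ne'
  rw [boost, lorBil_sub_left, lorBil_smul_left, lorBil_smul_left, ← lor_eq_lorBil,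
    lor_boostVec hy]
  field_simp
  ring

lemma lorBil_boost {y : Fin n → ℝ} (hy : y ∈ cone n) (u v : Fin n → ℝ) :
    lorBil (boost y u) (boost y v) = lor y * lorBil u v := by
  have h1 := (sqrt_add_pos hy).ne'
  have h2 := Real.sq_sqrt hy.1.le
  conv_lhs => rw [boost.eq_1 y v]
  rw [lorBil_sub_right, lorBil_smul_right, lorBil_smul_right, lorBil_boost_boostVec hy,
    boost, lorBil_sub_left, lorBil_smul_left, lorBil_smul_left, lorBil_comm (boostVec y) v]
  field_simp
  linear_combination (√(lor y) + y 0) * lorBil u v * h2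

lemma lor_boost {y : Fin n → ℝ} (hy : y ∈ cone n) (v : Fin n → ℝ) :
    lor (boost y v) = lor y * lor v := by
  rw [lor_eq_lorBil, lorBil_boost hy, lor_eq_lorBil v]

lemma boost_mem_cone {y v : Fin n → ℝ} (hy : y ∈ cone n) (hv : v ∈ cone n) :
    boost y v ∈ cone n := by
  refine mem_cone_of_lorBil_pos hy ?_ ?_
  · rw [lor_boost hy]; exact mul_pos hy.1 hv.1
  · have h := lorBil_boost hy (baseE n) v
    rw [boost_baseE hy, lorBil_baseE] at h
    rw [h]
    exact mul_pos hy.1 hv.2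

lemma boost_add (y u v : Fin n → ℝ) : boost y (u + v) = boost y u + boost y v := by
  rw [boost, boost, boost, lorBil_add_left, add_div, add_smul, smul_add]; abel

lemma boost_smul (y : Fin n → ℝ) (t : ℝ) (v : Fin n → ℝ) : boost y (t • v) = t • boost y v := by
  rw [boost, boost, lorBil_smul_left, smul_sub, smul_smul, smul_smul, smul_smul, mul_div_assoc,
    mul_comm √(lor y)]

lemma boost_sub (y u v : Fin n → ℝ) : boost y (u - v) = boost y u - boost y v := by
  rw [sub_eq_add_neg, boost_add, ← neg_one_smul ℝ v, boost_smul, neg_one_smul, ← sub_eq_add_neg]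

lemma boost_boost {y : Fin n → ℝ} (hy : y ∈ cone n) (v : Fin n → ℝ) :
    boost y (boost y v) = lor y • v := by
  have h2 := Real.sq_sqrt hy.1.le
  rw [boost.eq_1 y (boost y v), lorBil_boost_boostVec hy, boost, smul_sub, smul_smul, smul_smul,
    ← sq, h2, mul_div_assoc, sub_sub_cancel]

lemma lorBilC_toC_re (w : Fin n → ℂ) (v : Fin n → ℝ) :
    (lorBilC w (toC v)).re = lorBil (reP w) v := by
  simp [lorBilC, lorBil, toC, reP]

lemma lorBilC_toC_im (w : Fin n → ℂ) (v : Fin n → ℝ) :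
    (lorBilC w (toC v)).im = lorBil (imP w) v := by
  simp [lorBilC, lorBil, toC, imP]

lemma reP_boostC (y : Fin n → ℝ) (w : Fin n → ℂ) : reP (boostC y w) = boost y (reP w) := by
  ext i
  simp only [boostC, boost, reP, LinearMap.coe_mk, AddHom.coe_mk, Pi.sub_apply, Pi.smul_apply,
    smul_eq_mul, sub_re, toC, re_mul_ofReal, re_ofReal_mul, div_ofReal_re]
  rw [← lorBilC_toC_re]

lemma imP_boostC (y : Fin n → ℝ) (w : Fin n → ℂ) : imP (boostC y w) = boost y (imP w) := by
  ext i
  simp only [boostC, boost, imP, LinearMap.coe_mk, AddHom.coe_mk, Pi.sub_apply, Pi.smul_apply,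
    smul_eq_mul, sub_im, toC, im_mul_ofReal, im_ofReal_mul, div_ofReal_im]
  rw [← lorBilC_toC_im]

lemma ext_reP_imP {z w : Fin n → ℂ} (h1 : reP z = reP w) (h2 : imP z = imP w) : z = w := by
  ext i
  exact Complex.ext (congrFun h1 i) (congrFun h2 i)

lemma boostC_boostC {y : Fin n → ℝ} (hy : y ∈ cone n) (w : Fin n → ℂ) :
    boostC y (boostC y w) = (lor y : ℂ) • w := by
  apply ext_reP_imP
  · rw [reP_boostC, reP_boostC, boost_boost hy]; ext; simp [reP]
  · rw [imP_boostC, imP_boostC, boost_boost hy]; ext; simp [imP]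

lemma boostC_injective {y : Fin n → ℝ} (hy : y ∈ cone n) : Function.Injective (boostC y) := by
  intro u v h
  have h' := congrArg (boostC y) h
  rw [boostC_boostC hy, boostC_boostC hy] at h'
  exact smul_right_injective _ (by exact_mod_cast hy.1.ne') h'

lemma abs_det_boostC {y : Fin n → ℝ} (hy : y ∈ cone n) :
    |LinearMap.det ((boostC y).restrictScalars ℝ)| = lor y ^ n := by
  have h : (boostC y).restrictScalars ℝ ∘ₗ (boostC y).restrictScalars ℝ
      = (lor y) • (LinearMap.id : (Fin n → ℂ) →ₗ[ℝ] (Fin n → ℂ)) := by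
    refine LinearMap.ext fun w => ?_
    simp [boostC_boostC hy]
  have h2 := congrArg LinearMap.det h
  rw [LinearMap.det_comp, LinearMap.det_smul, LinearMap.det_id, mul_one] at h2
  have h3 : Module.finrank ℝ (Fin n → ℂ) = n * 2 := by
    rw [Module.finrank_pi_fintype]; simp
  rw [h3, pow_mul] at h2
  have hp : 0 < lor y ^ n := pow_pos hy.1 n
  rw [← abs_of_pos hp]
  exact (abs_eq_abs.2 (sq_eq_sq_iff_eq_or_eq_neg.1 (by rw [← h2, sq])))

end Boost

section ComplexAnalysis

variable {n : ℕ}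

lemma lineDeriv_eq_circle_integral {F : (Fin n → ℂ) → ℂ} {z v : Fin n → ℂ} {r : ℝ} (hr : 0 < r)
    (hF : ∀ l : ℂ, ‖l‖ ≤ r → DifferentiableAt ℂ F (z + l • v)) :
    fderiv ℂ F z v = (2 * Real.pi * I)⁻¹ *
      ∫ θ in (0 : ℝ)..2 * Real.pi, (deriv (circleMap 0 r) θ * (1 / circleMap 0 r θ ^ 2)) *
        F (z + circleMap 0 r θ • v) := by
  have hz : DifferentiableAt ℂ F z := by simpa using hF 0 (by simpa using hr.le)
  have hd : deriv (fun l : ℂ => F (z + l • v)) 0 = fderiv ℂ F z v := by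
    have := hz.hasFDerivAt.hasLineDerivAt v
    exact this.deriv
  have hdiff : DifferentiableOn ℂ (fun l : ℂ => F (z + l • v)) (Metric.closedBall 0 r) := by
    intro l hl
    have := hF l (by simpa using hl)
    exact (DifferentiableAt.comp (g := F) (f := fun l : ℂ => z + l • v) l this
      (by fun_prop)).differentiableWithinAt
  have h := hdiff.deriv_eq_smul_circleIntegral hr
  rw [hd] at h
  have h2 : (2 * Real.pi * I : ℂ) ≠ 0 := by simp [Real.pi_ne_zero]
  rw [smul_eq_mul] at h
  rw [eq_inv_mul_iff_mul_eq₀ h2, ← h, circleIntegral]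
  simp [mul_assoc]

/-- Directional derivatives of holomorphic functions are holomorphic. -/
theorem differentiableOn_fderiv_apply {F : (Fin n → ℂ) → ℂ} {U : Set (Fin n → ℂ)} (hU : IsOpen U)
    (hF : DifferentiableOn ℂ F U) (v : Fin n → ℂ) :
    DifferentiableOn ℂ (fun z => fderiv ℂ F z v) U := by
  intro z₀ hz₀
  have hFat : ∀ z ∈ U, DifferentiableAt ℂ F z := fun z hz => hF.differentiableAt (hU.mem_nhds hz)
  have hnear : ∀ᶠ z in nhds z₀, z ∈ U ∧ ‖F z‖ < ‖F z₀‖ + 1 :=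
    Filter.Eventually.and (hU.mem_nhds hz₀) ((hFat z₀ hz₀).continuousAt.norm.eventually_lt continuousAt_const
      (by linarith))
  obtain ⟨ε, hε, hball⟩ := Metric.eventually_nhds_iff_ball.1 hnear
  set δ := ε / 3 with hδ
  have hδ0 : 0 < δ := by positivity
  set M := ‖F z₀‖ + 1 with hM
  set r := δ / (‖v‖ + 1) with hr
  have hr0 : 0 < r := by positivity
  have hrv : r * ‖v‖ ≤ δ := by
    rw [hr, div_mul_eq_mul_div, div_le_iff₀ (by positivity)]
    nlinarith [norm_nonneg v]
  have hmem : ∀ z ∈ Metric.ball z₀ δ, ∀ l : ℂ, ‖l‖ ≤ r → z + l • v ∈ Metric.ball z₀ (2 * δ) := by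
    intro z hz l hl
    rw [mem_ball_iff_norm] at hz ⊢
    calc ‖z + l • v - z₀‖ = ‖(z - z₀) + l • v‖ := by congr 1; abel
      _ ≤ ‖z - z₀‖ + ‖l • v‖ := norm_add_le _ _
      _ < δ + δ := by
        rw [norm_smul]
        have := mul_le_mul_of_nonneg_right hl (norm_nonneg v)
        linarith
      _ = 2 * δ := by ring
  have hsub : ∀ z ∈ Metric.ball z₀ (2 * δ), z ∈ U := fun z hz =>
    (hball z (Metric.ball_subset_ball (by linarith) hz)).1
  have hcirc : ∀ θ, ‖circleMap 0 r θ‖ ≤ r := fun θ => by simp [abs_of_pos hr0]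
  set k : ℝ → ℂ := fun θ => deriv (circleMap 0 r) θ * (1 / circleMap 0 r θ ^ 2) with hk
  have hkc : Continuous k := by
    have h1 : Continuous (circleMap 0 r) := continuous_circleMap 0 r
    have h2 : ∀ θ, circleMap 0 r θ ^ 2 ≠ 0 := fun θ => by
      have := circleMap_ne_center (c := 0) (θ := θ) hr0.ne'
      positivity
    simp only [hk, deriv_circleMap]
    exact (h1.mul continuous_const).mul (continuous_const.div (h1.pow 2) h2)
  have hline : Continuous fun θ => z₀ + circleMap 0 r θ • v := by
    have h1 : Continuous (circleMap 0 r) := continuous_circleMap 0 r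
    fun_prop
  have hFcont : ∀ z ∈ Metric.ball z₀ δ, Continuous fun θ => k θ * F (z + circleMap 0 r θ • v) := by
    intro z hz
    refine hkc.mul (continuous_iff_continuousAt.2 fun θ => ?_)
    have h1 := (hFat _ (hsub _ (hmem z hz _ (hcirc θ)))).continuousAt
    have h2 : Continuous fun θ => z + circleMap 0 r θ • v := by
      have h1 : Continuous (circleMap 0 r) := continuous_circleMap 0 r
      fun_prop
    exact ContinuousAt.comp (f := fun θ => z + circleMap 0 r θ • v) h1 h2.continuousAt
  have hprop := FiniteDimensional.proper ℂ ((Fin n → ℂ) →L[ℂ] ℂ)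
  have key : HasFDerivAt (fun z => ∫ θ in (0 : ℝ)..2 * Real.pi, k θ * F (z + circleMap 0 r θ • v))
      (∫ θ in (0 : ℝ)..2 * Real.pi, k θ • fderiv ℂ F (z₀ + circleMap 0 r θ • v)) z₀ := by
    refine intervalIntegral.hasFDerivAt_integral_of_dominated_of_fderiv_le
      (F' := fun z θ => k θ • fderiv ℂ F (z + circleMap 0 r θ • v))
      (bound := fun θ => ‖k θ‖ * (2 * M / δ))
      (Metric.ball_mem_nhds z₀ hδ0) ?_ ?_ ?_ ?_ ?_ ?_
    · filter_upwards [Metric.ball_mem_nhds z₀ hδ0] with z hz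
      exact (hFcont z hz).aestronglyMeasurable
    · exact (hFcont z₀ (Metric.mem_ball_self hδ0)).intervalIntegrable _ _
    · refine (hkc.measurable.stronglyMeasurable.smul ?_).aestronglyMeasurable
      exact ((measurable_fderiv ℂ F).comp hline.measurable).stronglyMeasurable
    · refine Filter.Eventually.of_forall fun θ _ z hz => ?_
      rw [norm_smul]
      refine mul_le_mul_of_nonneg_left ?_ (norm_nonneg _)
      have hw := hmem z hz _ (hcirc θ)
      set w := z + circleMap 0 r θ • v
      have hbb : Metric.ball w δ ⊆ Metric.ball z₀ ε := by
        refine Metric.ball_subset_ball' ?_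
        have := Metric.mem_ball.1 hw
        linarith
      refine Complex.norm_fderiv_le_div_of_mapsTo_ball (fun x hx => ?_) (fun x hx => ?_) hδ0
      · exact (hFat x (hball x (hbb hx)).1).differentiableWithinAt
      · rw [mem_closedBall_iff_norm]
        have h1 := (hball x (hbb hx)).2
        have h2 := (hball w (hbb (Metric.mem_ball_self hδ0))).2
        linarith [norm_sub_le (F x) (F w)]
    · exact (hkc.norm.mul continuous_const).intervalIntegrable _ _
    · refine Filter.Eventually.of_forall fun θ _ z hz => ?_
      have h1 := (hFat _ (hsub _ (hmem z hz _ (hcirc θ)))).hasFDerivAt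
      have h2 : HasFDerivAt (fun z => F (z + circleMap 0 r θ • v))
          (fderiv ℂ F (z + circleMap 0 r θ • v)) z := by
        have h3 : HasFDerivAt (fun z : Fin n → ℂ => z + circleMap 0 r θ • v)
            (ContinuousLinearMap.id ℂ (Fin n → ℂ)) z := (hasFDerivAt_id z).add_const _
        have h4 := h1.comp z h3
        rwa [ContinuousLinearMap.comp_id] at h4
      exact h2.const_mul (k θ)
  have heq : (fun z => fderiv ℂ F z v) =ᶠ[nhds z₀] fun z => (2 * Real.pi * I)⁻¹ *
      ∫ θ in (0 : ℝ)..2 * Real.pi, k θ * F (z + circleMap 0 r θ • v) := by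
    filter_upwards [Metric.ball_mem_nhds z₀ hδ0] with z hz
    exact lineDeriv_eq_circle_integral hr0 fun l hl => hFat _ (hsub _ (hmem z hz l hl))
  exact ((key.differentiableAt.const_mul _).congr_of_eventuallyEq heq).differentiableWithinAt

lemma differentiableOn_pd {F : (Fin n → ℂ) → ℂ} {U : Set (Fin n → ℂ)} (hU : IsOpen U)
    (hF : DifferentiableOn ℂ F U) (i : Fin n) : DifferentiableOn ℂ (pd i F) U :=
  differentiableOn_fderiv_apply hU hF _

lemma differentiableOn_BoxOp [NeZero n] {F : (Fin n → ℂ) → ℂ} {U : Set (Fin n → ℂ)}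
    (hU : IsOpen U) (hF : DifferentiableOn ℂ F U) : DifferentiableOn ℂ (BoxOp F) U := by
  have h := fun i => differentiableOn_pd hU (differentiableOn_pd hU hF i) i
  unfold BoxOp
  exact (((h 0).const_mul 2).sub (DifferentiableOn.fun_sum fun i _ => h i)).neg

lemma differentiableOn_BoxOp_iterate [NeZero n] {F : (Fin n → ℂ) → ℂ} {U : Set (Fin n → ℂ)}
    (hU : IsOpen U) (hF : DifferentiableOn ℂ F U) (k : ℕ) :
    DifferentiableOn ℂ (BoxOp^[k] F) U := by
  induction k with
  | zero => exact hF
  | succ k ih =>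
    rw [Function.iterate_succ_apply']
    exact differentiableOn_BoxOp hU ih

end ComplexAnalysis

section MeanValue

variable {n : ℕ}

lemma measurePreserving_smul_of_norm_eq_one {a : ℂ} (ha : ‖a‖ = 1) :
    MeasurePreserving (fun w : Fin n → ℂ => a • w) volume volume := by
  have h : MeasurePreserving (fun x : ℂ => a * x) volume volume := by
    have := (rotation ⟨a, mem_sphere_zero_iff_norm.2 ha⟩).measurePreserving
    exact this
  exact volume_preserving_pi (fun _ => h)

/-- The sub-mean value inequality for holomorphic functions on sup-norm balls. -/
lemma volume_ball_mul_enorm_le {H : (Fin n → ℂ) → ℂ} {c : Fin n → ℂ} {r : ℝ}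
    (hH : DifferentiableOn ℂ H (Metric.ball c r)) :
    volume (Metric.ball (0 : Fin n → ℂ) r) * ‖H c‖ₑ ≤
      ∫⁻ w in Metric.ball (0 : Fin n → ℂ) r, ‖H (c + w)‖ₑ := by
  set S := Metric.ball (0 : Fin n → ℂ) r with hS
  have hSm : MeasurableSet S := Metric.isOpen_ball.measurableSet
  have hmem : ∀ w ∈ S, c + w ∈ Metric.ball c r := fun w hw => by simpa [hS] using hw
  set Φ : (Fin n → ℂ) → ℝ≥0∞ := S.indicator (fun w => ‖H (c + w)‖ₑ) with hΦ
  have hc : ContinuousOn (fun w => ‖H (c + w)‖ₑ) S := by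
    refine continuous_enorm.comp_continuousOn (hH.continuousOn.comp (by fun_prop) hmem)
  have hΦm : Measurable Φ := by
    classical
    rw [hΦ, ← Set.piecewise_eq_indicator]
    exact hc.measurable_piecewise continuousOn_const hSm
  have hpi : (0 : ℝ) ≤ 2 * Real.pi := by positivity
  set K : Set ℝ := Set.Ioc 0 (2 * Real.pi) with hK
  have hKv : volume K = ENNReal.ofReal (2 * Real.pi) := by simp [hK]
  have hmul : ∀ θ : ℝ, ∀ w, circleMap 0 1 θ • w ∈ S ↔ w ∈ S := fun θ w => by
    simp [hS, norm_smul]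
  have hone : ∀ w ∈ S, ENNReal.ofReal (2 * Real.pi) * ‖H c‖ₑ ≤
      ∫⁻ θ in K, Φ (circleMap 0 1 θ • w) := by
    intro w hw
    have hd : DiffContOnCl ℂ (fun l : ℂ => H (c + l • w)) (Metric.ball 0 |1|) := by
      refine DifferentiableOn.diffContOnCl ?_
      rw [abs_one, closure_ball _ one_ne_zero]
      refine hH.comp (by fun_prop) fun l hl => hmem _ ?_
      rw [hS, mem_ball_zero_iff, norm_smul]
      have h1 : ‖l‖ ≤ 1 := by simpa using hl
      have h2 : ‖w‖ < r := by simpa [hS] using hw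
      nlinarith [norm_nonneg w]
    have h := hd.circleAverage
    rw [Real.circleAverage_def, zero_smul, add_zero] at h
    have h2 : ((2 * Real.pi : ℝ)) • H c =
        ∫ θ in (0 : ℝ)..2 * Real.pi, H (c + circleMap 0 1 θ • w) := by
      rw [← h, smul_smul, mul_inv_cancel₀ (by positivity), one_smul]
    have h3 : ENNReal.ofReal (2 * Real.pi) * ‖H c‖ₑ = ‖(2 * Real.pi : ℝ) • H c‖ₑ := by
      rw [enorm_smul, Real.enorm_eq_ofReal hpi]
    rw [h3, h2, intervalIntegral.integral_of_le hpi]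
    refine (enorm_integral_le_lintegral_enorm _).trans (lintegral_mono fun θ => ?_)
    simp [hΦ, (hmul θ w).2 hw]
  have hmeas2 : Measurable fun q : (Fin n → ℂ) × ℝ => Φ (circleMap 0 1 q.2 • q.1) := by
    refine hΦm.comp (Continuous.measurable ?_)
    have h1 : Continuous (circleMap 0 1) := continuous_circleMap 0 1
    fun_prop
  have hmain : ENNReal.ofReal (2 * Real.pi) * (volume S * ‖H c‖ₑ) ≤
      ENNReal.ofReal (2 * Real.pi) * ∫⁻ w in S, ‖H (c + w)‖ₑ := by
    calc ENNReal.ofReal (2 * Real.pi) * (volume S * ‖H c‖ₑ)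
        = ∫⁻ w in S, ENNReal.ofReal (2 * Real.pi) * ‖H c‖ₑ := by
          rw [setLIntegral_const]; ring
      _ ≤ ∫⁻ w in S, ∫⁻ θ in K, Φ (circleMap 0 1 θ • w) := setLIntegral_mono' hSm hone
      _ ≤ ∫⁻ w, ∫⁻ θ in K, Φ (circleMap 0 1 θ • w) := setLIntegral_le_lintegral _ _
      _ = ∫⁻ θ in K, ∫⁻ w, Φ (circleMap 0 1 θ • w) :=
          lintegral_lintegral_swap hmeas2.aemeasurable
      _ = ∫⁻ θ in K, ∫⁻ w, Φ w := by
          refine lintegral_congr fun θ => ?_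
          exact (measurePreserving_smul_of_norm_eq_one (by simp)).lintegral_comp hΦm
      _ = ENNReal.ofReal (2 * Real.pi) * ∫⁻ w in S, ‖H (c + w)‖ₑ := by
          rw [setLIntegral_const, hKv, mul_comm, hΦ, lintegral_indicator hSm]
  rwa [ENNReal.mul_le_mul_iff_right (by positivity) ENNReal.ofReal_ne_top] at hmain

end MeanValue

section PointwiseEstimate

variable {n : ℕ} [NeZero n]

lemma boostC_single (y : Fin n → ℝ) (j : Fin n) :
    boostC y (Pi.single j 1) =
      ((2 * ((Pi.single j 1 : Fin n → ℂ) 0 * toC (boostVec y) 0) - toC (boostVec y) j)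
        / (√(lor y) + y 0 : ℝ)) • toC (boostVec y) - (√(lor y) : ℂ) • Pi.single j 1 := by
  have : lorBilC (Pi.single j 1) (toC (boostVec y)) =
      2 * ((Pi.single j 1 : Fin n → ℂ) 0 * toC (boostVec y) 0) - toC (boostVec y) j := by
    simp [lorBilC, Pi.single_apply]
  rw [← this]; rfl

/-- The trace of a bilinear form against the Lorentz form is conformally covariant. -/
lemma lorentz_trace_boostC {y : Fin n → ℝ} (hy : y ∈ cone n)
    (B : (Fin n → ℂ) →ₗ[ℂ] (Fin n → ℂ) →ₗ[ℂ] ℂ) :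
    2 * B (boostC y (Pi.single 0 1)) (boostC y (Pi.single 0 1))
        - ∑ j, B (boostC y (Pi.single j 1)) (boostC y (Pi.single j 1))
      = lor y * (2 * B (Pi.single 0 1) (Pi.single 0 1)
        - ∑ j, B (Pi.single j 1) (Pi.single j 1)) := by
  have h1 : ((√(lor y) + y 0 : ℝ) : ℂ) ≠ 0 := by exact_mod_cast (sqrt_add_pos hy).ne'
  have h2 : (√(lor y) : ℂ) ^ 2 = lor y := by exact_mod_cast Real.sq_sqrt hy.1.le
  have h3 : lorC (toC (boostVec y)) = 2 * (√(lor y) : ℂ) * (√(lor y) + y 0 : ℝ) := by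
    rw [lorC_toC, lor_boostVec hy]; push_cast; ring
  set k : ℂ := ((√(lor y) + y 0 : ℝ) : ℂ) with hk
  set s : ℂ := (√(lor y) : ℂ) with hs
  set m := toC (boostVec y) with hm
  set c : Fin n → ℂ := fun j => 2 * ((Pi.single j 1 : Fin n → ℂ) 0 * m 0) - m j with hc
  have hc0 : c 0 = m 0 := by simp [hc]; ring
  have hcj : ∀ j ≠ 0, c j = -m j := fun j hj => by simp [hc, Pi.single_apply, hj.symm]
  have hcsq : ∀ j, c j ^ 2 = m j ^ 2 := fun j => by
    by_cases hj : j = 0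
    · rw [hj, hc0]
    · rw [hcj j hj]; ring
  have hm' : m = ∑ j, m j • (Pi.single j 1 : Fin n → ℂ) := pi_eq_sum_univ' m
  have hsum : ∀ X : Fin n → ℂ, 2 * (c 0 * X 0) - ∑ j, c j * X j = ∑ j, m j * X j := by
    intro X
    have : ∀ j, c j * X j = 2 * ((Pi.single 0 (m 0 * X 0) : Fin n → ℂ) j) - m j * X j := fun j => by
      by_cases hj : j = 0
      · subst hj; rw [hc0]; simp; ring
      · rw [hcj j hj]; simp [hj]
    rw [Finset.sum_congr rfl fun j _ => this j, Finset.sum_sub_distrib, ← Finset.mul_sum, hc0]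
    simp
  have hR : ∑ j, m j * B m (Pi.single j 1) = B m m := by
    conv_rhs => rw [hm']
    rw [map_sum]; simp [← hm']
  have hL : ∑ j, m j * B (Pi.single j 1) m = B m m := by
    have : B m m = B.flip m m := rfl
    rw [this]
    conv_rhs => rw [hm']
    rw [map_sum]; simp [← hm']
  have hexp : ∀ j, B (boostC y (Pi.single j 1)) (boostC y (Pi.single j 1)) =
      (B m m / k ^ 2) * m j ^ 2 - (s / k) * (c j * (B m (Pi.single j 1) + B (Pi.single j 1) m))
        + s ^ 2 * B (Pi.single j 1) (Pi.single j 1) := by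
    intro j
    rw [boostC_single]
    have := hcsq j
    simp only [← hm, ← hk, ← hs, map_sub, map_smul, LinearMap.sub_apply, LinearMap.smul_apply,
      smul_eq_mul]
    change c j / k * (c j / k * _ - _) - _ = _
    rw [← this]
    field_simp
    ring
  have hX := hsum fun j => B m (Pi.single j 1) + B (Pi.single j 1) m
  simp only [mul_add, Finset.sum_add_distrib, hR, hL] at hX
  rw [lorC] at h3
  simp only [hexp, Finset.sum_add_distrib, Finset.sum_sub_distrib, ← Finset.mul_sum]
  simp only [mul_add, Finset.sum_add_distrib]
  rw [← h2]
  field_simp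
  linear_combination (B m m) * h3 - s * k * hX

end PointwiseEstimate

section PointwiseEstimate

variable {n : ℕ} [NeZero n]

/-- The second derivative of a holomorphic function as a bilinear form. -/
def secondDeriv {n : ℕ} (G : (Fin n → ℂ) → ℂ) {U : Set (Fin n → ℂ)} (hU : IsOpen U)
    (hG : DifferentiableOn ℂ G U) {z : Fin n → ℂ} (hz : z ∈ U) :
    (Fin n → ℂ) →ₗ[ℂ] (Fin n → ℂ) →ₗ[ℂ] ℂ :=
  LinearMap.mk₂ ℂ (fun u v => fderiv ℂ (fun z' => fderiv ℂ G z' u) z v)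
    (fun u u' v => by
      have h := fun u => (differentiableOn_fderiv_apply hU hG u).differentiableAt (hU.mem_nhds hz)
      simp only [map_add]
      rw [fderiv_fun_add (h u) (h u')]; rfl)
    (fun c u v => by
      have h := (differentiableOn_fderiv_apply hU hG u).differentiableAt (hU.mem_nhds hz)
      simp only [map_smul]
      rw [fderiv_fun_const_smul h]; rfl)
    (fun u v v' => map_add _ _ _)
    (fun c u v => map_smul _ _ _)

lemma iteratedDeriv_two_line {G : (Fin n → ℂ) → ℂ} {U : Set (Fin n → ℂ)} (hU : IsOpen U)
    (hG : DifferentiableOn ℂ G U) {z : Fin n → ℂ} (hz : z ∈ U) (u : Fin n → ℂ) :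
    iteratedDeriv 2 (fun l : ℂ => G (z + l • u)) 0 = secondDeriv G hU hG hz u u := by
  have hline : ∀ l : ℂ, HasDerivAt (fun l : ℂ => z + l • u) u l := fun l => by
    simpa using ((hasDerivAt_id l).smul_const u).const_add z
  have hcont : Continuous fun l : ℂ => z + l • u := by fun_prop
  have hev : ∀ᶠ l : ℂ in nhds 0, z + l • u ∈ U :=
    hcont.continuousAt.eventually (by simpa using hU.mem_nhds hz)
  have h1 : deriv (fun l : ℂ => G (z + l • u)) =ᶠ[nhds 0] fun l => fderiv ℂ G (z + l • u) u := by
    filter_upwards [hev] with l hl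
    exact ((hG.differentiableAt (hU.mem_nhds hl)).hasFDerivAt.comp_hasDerivAt l (hline l)).deriv
  rw [iteratedDeriv_succ, iteratedDeriv_one, h1.deriv_eq]
  have h2 := ((differentiableOn_fderiv_apply hU hG u).differentiableAt (hU.mem_nhds hz)).hasFDerivAt
  have hz0 : z + (0 : ℂ) • u = z := by simp
  rw [← hz0] at h2
  have h3 := (h2.comp_hasDerivAt (0 : ℂ) (hline 0)).deriv
  rw [hz0] at h3
  exact h3

lemma BoxOp_eq_secondDeriv {G : (Fin n → ℂ) → ℂ} {U : Set (Fin n → ℂ)} (hU : IsOpen U)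
    (hG : DifferentiableOn ℂ G U) {z : Fin n → ℂ} (hz : z ∈ U) :
    BoxOp G z = -(2 * secondDeriv G hU hG hz (Pi.single 0 1) (Pi.single 0 1)
      - ∑ j, secondDeriv G hU hG hz (Pi.single j 1) (Pi.single j 1)) := rfl

lemma half_baseE_add_mem {v : Fin n → ℝ} (hv : ∀ i, |v i| < 1 / (8 * n)) :
    (1 / 2 : ℝ) • baseE n + v ∈ cone n := by
  have hn : (1 : ℝ) ≤ n := by exact_mod_cast NeZero.one_le
  have hb : (1 : ℝ) / (8 * n) ≤ 1 / 8 := by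
    rw [div_le_div_iff₀ (by positivity) (by norm_num)]; linarith
  have h0 := abs_lt.1 (hv 0)
  have hs : ∑ i, v i ^ 2 ≤ ∑ _i : Fin n, 1 / (64 * (n : ℝ)) := by
    refine Finset.sum_le_sum fun i _ => ?_
    have h1 : v i ^ 2 ≤ (1 / (8 * (n : ℝ))) ^ 2 := by
      rw [← sq_abs]; exact pow_le_pow_left₀ (abs_nonneg _) (hv i).le 2
    refine h1.trans ?_
    rw [div_pow, one_pow, div_le_div_iff₀ (by positivity) (by positivity)]
    nlinarith
  have hs2 : ∑ _i : Fin n, 1 / (64 * (n : ℝ)) = 1 / 64 := by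
    simp; field_simp
  constructor
  · rw [lor_add, lor_smul, lor_baseE, lorBil_smul_left, lorBil_baseE]
    unfold lor
    nlinarith [sq_nonneg (v 0)]
  · simp [baseE]; linarith

/-- The points whose distance to `z` is controlled by the imaginary part of `z`, up to the action
of the automorphisms of the cone. -/
def nearSet (z : Fin n → ℂ) : Set (Fin n → ℂ) :=
  {w | imP w - (1 / 2 : ℝ) • imP z ∈ cone n ∧ (2 : ℝ) • imP z - imP w ∈ cone n ∧
    imP z + (reP w - reP z) ∈ cone n ∧ imP z - (reP w - reP z) ∈ cone n}

lemma add_boostC_mem_nearSet {z w : Fin n → ℂ} (hz : z ∈ tube n) (hw : ‖w‖ < 1 / (8 * n)) :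
    z + boostC (imP z) w ∈ nearSet z := by
  have hy : imP z ∈ cone n := hz
  have hre : ∀ i, |reP w i| < 1 / (8 * n) := fun i =>
    (abs_re_le_norm _).trans_lt ((norm_le_pi_norm w i).trans_lt hw)
  have him : ∀ i, |imP w i| < 1 / (8 * n) := fun i =>
    (abs_im_le_norm _).trans_lt ((norm_le_pi_norm w i).trans_lt hw)
  have hhalf : (1 / 2 : ℝ) • baseE n ∈ cone n := smul_mem_cone (by norm_num) baseE_mem
  have hfull : ∀ v : Fin n → ℝ, (∀ i, |v i| < 1 / (8 * n)) → baseE n + v ∈ cone n := fun v hv => by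
    have := add_mem_cone hhalf (half_baseE_add_mem hv)
    rwa [← add_assoc, ← add_smul, add_halves, one_smul] at this
  have hneg : ∀ v : Fin n → ℝ, (∀ i, |v i| < 1 / (8 * n)) → ∀ i, |(-v) i| < 1 / (8 * n) :=
    fun v hv i => by simpa using hv i
  have hsub : ∀ v : Fin n → ℝ, boost (imP z) (-v) = -boost (imP z) v := fun v => by
    rw [← neg_one_smul ℝ v, boost_smul, neg_one_smul]
  refine ⟨?_, ?_, ?_, ?_⟩
  · have := boost_mem_cone hy (half_baseE_add_mem him)
    rw [boost_add, boost_smul, boost_baseE hy] at this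
    rw [imP_add, imP_boostC]
    convert this using 1
    module
  · have := boost_mem_cone hy (hfull _ (hneg _ him))
    rw [boost_add, boost_baseE hy, hsub] at this
    rw [imP_add, imP_boostC]
    convert this using 1
    module
  · have := boost_mem_cone hy (hfull _ hre)
    rw [boost_add, boost_baseE hy] at this
    rw [reP_add, reP_boostC]
    convert this using 1
    module
  · have := boost_mem_cone hy (hfull _ (hneg _ hre))
    rw [boost_add, boost_baseE hy, hsub] at this
    rw [reP_add, reP_boostC]
    convert this using 1
    module

lemma nearSet_subset_tube {z : Fin n → ℂ} (hz : z ∈ tube n) : nearSet z ⊆ tube n := by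
  intro w hw
  have := add_mem_cone hw.1 (smul_mem_cone (t := 1 / 2) (by norm_num) hz)
  rwa [sub_add_cancel] at this

lemma isOpen_nearSet_prod :
    IsOpen {q : (Fin n → ℂ) × (Fin n → ℂ) | q.2 ∈ nearSet q.1} := by
  have h1 : Continuous fun q : (Fin n → ℂ) × (Fin n → ℂ) => imP q.1 :=
    continuous_imP.comp continuous_fst
  have h2 : Continuous fun q : (Fin n → ℂ) × (Fin n → ℂ) => imP q.2 :=
    continuous_imP.comp continuous_snd
  have h3 : Continuous fun q : (Fin n → ℂ) × (Fin n → ℂ) => reP q.1 :=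
    continuous_reP.comp continuous_fst
  have h4 : Continuous fun q : (Fin n → ℂ) × (Fin n → ℂ) => reP q.2 :=
    continuous_reP.comp continuous_snd
  exact (isOpen_cone.preimage (h2.sub (h1.const_smul (1 / 2 : ℝ)))).inter
    ((isOpen_cone.preimage ((h1.const_smul (2 : ℝ)).sub h2)).inter
    ((isOpen_cone.preimage (h1.add (h4.sub h3))).inter
      (isOpen_cone.preimage (h1.sub (h4.sub h3)))))

lemma isOpen_nearSet (z : Fin n → ℂ) : IsOpen (nearSet z) :=
  isOpen_nearSet_prod.preimage (by fun_prop : Continuous fun w : Fin n → ℂ => (z, w))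

end PointwiseEstimate

section PointwiseEstimate

variable {n : ℕ} [NeZero n]

lemma lintegral_image_add_boostC {y : Fin n → ℝ} (hy : y ∈ cone n) (z : Fin n → ℂ)
    {S : Set (Fin n → ℂ)} (hS : MeasurableSet S) (g : (Fin n → ℂ) → ℝ≥0∞) :
    ∫⁻ w in (fun w => z + boostC y w) '' S, g w =
      ENNReal.ofReal (lor y ^ n) * ∫⁻ w in S, g (z + boostC y w) := by
  set L : (Fin n → ℂ) →L[ℝ] (Fin n → ℂ) :=
    LinearMap.toContinuousLinearMap ((boostC y).restrictScalars ℝ) with hL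
  have hder : ∀ w ∈ S, HasFDerivWithinAt (fun w => z + boostC y w) L S w := fun w _ =>
    (L.hasFDerivAt.const_add z).hasFDerivWithinAt
  have hinj : InjOn (fun w => z + boostC y w) S := fun u _ v _ h =>
    boostC_injective hy (add_left_cancel h)
  rw [lintegral_image_eq_lintegral_abs_det_fderiv_mul volume hS hder hinj]
  have hdet : |L.det| = lor y ^ n := abs_det_boostC hy
  rw [hdet, lintegral_const_mul' _ _ ENNReal.ofReal_ne_top]

lemma enorm_secondDeriv_boostC_le {G : (Fin n → ℂ) → ℂ} (hG : DifferentiableOn ℂ G (tube n))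
    {z : Fin n → ℂ} (hz : z ∈ tube n) {r : ℝ} (hr : 0 < r) (hrn : 2 * r < 1 / (8 * n)) (j : Fin n)
    {M : ℝ} (hM : ∀ w ∈ Metric.sphere (0 : ℂ) r,
      ‖G (z + w • boostC (imP z) (Pi.single j 1))‖ ≤ M) :
    ‖secondDeriv G isOpen_tube hG hz (boostC (imP z) (Pi.single j 1))
      (boostC (imP z) (Pi.single j 1))‖ ≤ 2 * M / r ^ 2 := by
  rw [← iteratedDeriv_two_line]
  have hd : DiffContOnCl ℂ (fun l : ℂ => G (z + l • boostC (imP z) (Pi.single j 1)))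
      (Metric.ball 0 r) := by
    refine DifferentiableOn.diffContOnCl ?_
    rw [closure_ball _ hr.ne']
    refine hG.comp (by fun_prop) fun l hl => ?_
    rw [← map_smul]
    refine nearSet_subset_tube hz (add_boostC_mem_nearSet hz ?_)
    have h1 : ‖l‖ ≤ r := by simpa using hl
    rw [norm_smul, Pi.norm_single]
    simp; simp at hrn; linarith
  simpa using Complex.norm_iteratedDeriv_le_of_forall_mem_sphere_norm_le 2 hr hd hM

/-- The Box operator, rescaled by `Δ(Im z)`, is controlled by local averages. -/
lemma exists_enorm_lor_mul_BoxOp_le (n : ℕ) [NeZero n] : ∃ C : ℝ≥0∞, C ≠ ⊤ ∧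
    ∀ G : (Fin n → ℂ) → ℂ, DifferentiableOn ℂ G (tube n) → ∀ z ∈ tube n,
      ENNReal.ofReal (lor (imP z) ^ n) * ‖(lor (imP z) : ℂ) * BoxOp G z‖ₑ ≤
        C * ∫⁻ w in nearSet z, ‖G w‖ₑ := by
  have hn : (1 : ℝ) ≤ n := by exact_mod_cast NeZero.one_le
  set r : ℝ := 1 / (32 * n) with hr
  have hr0 : 0 < r := by positivity
  have hrn : 2 * r < 1 / (8 * n) := by
    rw [hr, lt_div_iff₀ (by positivity)]; field_simp; norm_num
  set V := volume (Metric.ball (0 : Fin n → ℂ) r) with hV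
  have hV0 : V ≠ 0 := (Metric.measure_ball_pos volume _ hr0).ne'
  have hVt : V ≠ ⊤ := measure_ball_lt_top.ne
  refine ⟨ENNReal.ofReal ((n + 2) * (2 / r ^ 2)) / V,
    ENNReal.div_ne_top ENNReal.ofReal_ne_top hV0, fun G hG z hz => ?_⟩
  have hy : imP z ∈ cone n := hz
  set y := imP z with hyd
  set A := ∫⁻ w in Metric.ball (0 : Fin n → ℂ) (2 * r), ‖G (z + boostC y w)‖ₑ with hA
  have hmem : ∀ w ∈ Metric.ball (0 : Fin n → ℂ) (2 * r), z + boostC y w ∈ nearSet z := fun w hw =>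
    add_boostC_mem_nearSet hz ((mem_ball_zero_iff.1 hw).trans hrn)
  have hAW : ENNReal.ofReal (lor y ^ n) * A ≤ ∫⁻ w in nearSet z, ‖G w‖ₑ := by
    rw [hA, ← lintegral_image_add_boostC hy z Metric.isOpen_ball.measurableSet (fun w => ‖G w‖ₑ)]
    exact lintegral_mono_set (image_subset_iff.2 hmem)
  have hBA : ‖(lor y : ℂ) * BoxOp G z‖ₑ ≤ ENNReal.ofReal ((n + 2) * (2 / r ^ 2)) / V * A := by
    by_cases hAt : A = ⊤
    · rw [hAt, ENNReal.mul_top]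
      · exact le_top
      · refine (ENNReal.div_pos ?_ hVt).ne'
        have : 0 < ((n : ℝ) + 2) * (2 / r ^ 2) := by positivity
        exact (ENNReal.ofReal_pos.2 this).ne'
    set M := (A / V).toReal with hM
    have hAV : A / V ≠ ⊤ := ENNReal.div_ne_top hAt hV0
    have hdiff : DifferentiableOn ℂ (fun w => G (z + boostC y w))
        (Metric.ball (0 : Fin n → ℂ) (2 * r)) := by
      refine hG.comp ?_ fun w hw => nearSet_subset_tube hz (hmem w hw)
      have : Differentiable ℂ (boostC y) := (LinearMap.toContinuousLinearMap (boostC y)).differentiable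
      exact (this.const_add z).differentiableOn
    have hsup : ∀ j : Fin n, ∀ l ∈ Metric.sphere (0 : ℂ) r,
        ‖G (z + l • boostC y (Pi.single j 1))‖ ≤ M := by
      intro j l hl
      have hl' : ‖l‖ = r := by simpa using hl
      rw [← map_smul]
      set c : Fin n → ℂ := l • Pi.single j 1 with hc
      have hcn : ‖c‖ = r := by rw [hc, norm_smul, Pi.norm_single]; simp [hl']
      have hbb : Metric.ball c r ⊆ Metric.ball 0 (2 * r) := by
        refine Metric.ball_subset_ball' ?_
        rw [dist_zero_right, hcn]; linarith
      have h := volume_ball_mul_enorm_le (hdiff.mono hbb)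
      have h2 : ∫⁻ w in Metric.ball (0 : Fin n → ℂ) r, ‖G (z + boostC y (c + w))‖ₑ ≤ A := by
        have hmp : MeasurePreserving (fun w : Fin n → ℂ => c + w) volume volume :=
          measurePreserving_add_left volume c
        have hpre : (fun w : Fin n → ℂ => c + w) ⁻¹' Metric.ball c r = Metric.ball 0 r := by
          ext w; simp
        have := hmp.setLIntegral_comp_preimage_emb (measurableEmbedding_addLeft c)
          (fun w => ‖G (z + boostC y w)‖ₑ) (Metric.ball c r)
        rw [hpre] at this
        rw [this]
        exact lintegral_mono_set hbb
      have h3 : ‖G (z + boostC y c)‖ₑ ≤ A / V := by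
        rw [ENNReal.le_div_iff_mul_le (Or.inl hV0) (Or.inl hVt), mul_comm]
        exact h.trans h2
      rw [hM, ← toReal_enorm]
      exact ENNReal.toReal_mono hAV h3
    have hM0 : 0 ≤ M := ENNReal.toReal_nonneg
    have hS := fun j => enorm_secondDeriv_boostC_le hG hz hr0 hrn j (hsup j)
    rw [BoxOp_eq_secondDeriv isOpen_tube hG hz, mul_neg, ← lorentz_trace_boostC hy, enorm_neg]
    have hnorm : ‖2 * secondDeriv G isOpen_tube hG hz (boostC y (Pi.single 0 1))
        (boostC y (Pi.single 0 1)) - ∑ j, secondDeriv G isOpen_tube hG hz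
        (boostC y (Pi.single j 1)) (boostC y (Pi.single j 1))‖ ≤ (n + 2) * (2 / r ^ 2) * M := by
      refine (norm_sub_le _ _).trans ?_
      have h1 := norm_sum_le_of_le Finset.univ fun j _ => hS j
      simp only [Finset.sum_const, Finset.card_univ, Fintype.card_fin, nsmul_eq_mul] at h1
      have h2 := hS 0
      rw [norm_mul, RCLike.norm_ofNat]
      calc _ ≤ 2 * (2 * M / r ^ 2) + n * (2 * M / r ^ 2) := by gcongr
        _ = _ := by ring
    rw [← ofReal_norm]
    refine (ENNReal.ofReal_le_ofReal hnorm).trans ?_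
    rw [ENNReal.ofReal_mul (by positivity), hM, ENNReal.ofReal_toReal hAV, div_eq_mul_inv A V,
      div_eq_mul_inv (ENNReal.ofReal _) V]
    exact le_of_eq (by ring)
  calc _ ≤ ENNReal.ofReal (lor y ^ n) * (ENNReal.ofReal ((n + 2) * (2 / r ^ 2)) / V * A) := by gcongr
    _ = ENNReal.ofReal ((n + 2) * (2 / r ^ 2)) / V * (ENNReal.ofReal (lor y ^ n) * A) := by ring
    _ ≤ _ := by gcongr

end PointwiseEstimate

section NearSetVolume

variable {n : ℕ} [NeZero n]

lemma sq_le_of_mem_cone {u : Fin n → ℝ} (hu : u ∈ cone n) (i : Fin n) : |u i| ≤ u 0 := by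
  by_cases hi : i = 0
  · rw [hi, abs_of_pos hu.2]
  · refine abs_le_of_sq_le_sq ?_ hu.2.le
    have h1 := hu.1
    have h2 : u i ^ 2 ≤ ∑ i, u i ^ 2 - u 0 ^ 2 := by
      rw [sum_sub_zero (fun i => u i ^ 2)]
      exact Finset.single_le_sum (f := fun i => u i ^ 2) (fun j _ => sq_nonneg _) (by simp [hi])
    unfold lor at h1
    linarith

lemma abs_lt_four_of_mem_cone {v : Fin n → ℝ} (h1 : (2 : ℝ) • baseE n + v ∈ cone n)
    (h2 : (2 : ℝ) • baseE n - v ∈ cone n) (i : Fin n) : |v i| < 4 := by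
  have h3 := h1.2
  have h4 := h2.2
  simp only [baseE, Pi.add_apply, Pi.sub_apply, Pi.smul_apply, Pi.single_eq_same, smul_eq_mul,
    mul_one] at h3 h4
  by_cases hi : i = 0
  · rw [hi, abs_lt]; constructor <;> linarith
  · have h5 := sq_le_of_mem_cone h1 i
    simp only [baseE, Pi.add_apply, Pi.smul_apply, Pi.single_eq_same, smul_eq_mul,
      mul_one, Pi.single_eq_of_ne hi, mul_zero, zero_add] at h5
    linarith

/-- A symmetric neighbourhood of the origin of size comparable to `y`. -/
def symmSet (y : Fin n → ℝ) : Set (Fin n → ℂ) :=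
  {w | (2 : ℝ) • y + imP w ∈ cone n ∧ (2 : ℝ) • y - imP w ∈ cone n ∧
    (2 : ℝ) • y + reP w ∈ cone n ∧ (2 : ℝ) • y - reP w ∈ cone n}

lemma symmSet_subset_image {y : Fin n → ℝ} (hy : y ∈ cone n) :
    symmSet y ⊆ (fun w => 0 + boostC y w) '' Metric.ball 0 8 := by
  intro w hw
  have hl := hy.1
  have hyy : boost y y = lor y • baseE n := by
    conv_lhs => rw [← boost_baseE hy, boost_baseE hy]
    rw [← boost_boost hy, boost_baseE hy]
  have hb : ∀ v : Fin n → ℝ, (2 : ℝ) • y + v ∈ cone n → (2 : ℝ) • y - v ∈ cone n →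
      ∀ i, |((lor y)⁻¹ • boost y v) i| < 4 := by
    intro v h1 h2
    have hscal : (lor y)⁻¹ * 2 * lor y = 2 := by field_simp
    have h3 := smul_mem_cone (inv_pos.2 hl) (boost_mem_cone hy h1)
    have h4 := smul_mem_cone (inv_pos.2 hl) (boost_mem_cone hy h2)
    rw [boost_add, boost_smul, hyy, smul_add, smul_smul, smul_smul, hscal] at h3
    rw [boost_sub, boost_smul, hyy, smul_sub, smul_smul, smul_smul, hscal] at h4
    exact abs_lt_four_of_mem_cone h3 h4
  refine ⟨((lor y : ℂ))⁻¹ • boostC y w, ?_, ?_⟩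
  · rw [mem_ball_zero_iff, pi_norm_lt_iff (by norm_num)]
    intro i
    have h1 := hb _ hw.1 hw.2.1 i
    have h2 := hb _ hw.2.2.1 hw.2.2.2 i
    rw [← imP_boostC] at h1
    rw [← reP_boostC] at h2
    refine (norm_le_abs_re_add_abs_im _).trans_lt ?_
    have h3 : ((((lor y : ℂ))⁻¹ • boostC y w) i).re = ((lor y)⁻¹ • reP (boostC y w)) i := by
      simp only [Pi.smul_apply, smul_eq_mul, reP, ← ofReal_inv, re_ofReal_mul]
    have h4 : ((((lor y : ℂ))⁻¹ • boostC y w) i).im = ((lor y)⁻¹ • imP (boostC y w)) i := by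
      simp only [Pi.smul_apply, smul_eq_mul, imP, ← ofReal_inv, im_ofReal_mul]
    rw [h3, h4]
    linarith
  · have hl' : (lor y : ℂ) ≠ 0 := by exact_mod_cast hl.ne'
    simp only [map_smul, boostC_boostC hy, smul_smul, inv_mul_cancel₀ hl', one_smul, zero_add]

lemma volume_symmSet_le {y : Fin n → ℝ} (hy : y ∈ cone n) :
    volume (symmSet y) ≤ ENNReal.ofReal (lor y ^ n) * volume (Metric.ball (0 : Fin n → ℂ) 8) := by
  refine (measure_mono (symmSet_subset_image hy)).trans ?_
  have := lintegral_image_add_boostC hy 0 (S := Metric.ball 0 8)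
    Metric.isOpen_ball.measurableSet (fun _ => 1)
  simpa using this.le

lemma sub_mem_symmSet_left {z w : Fin n → ℂ} (hz : z ∈ tube n) (hw : w ∈ nearSet z) :
    w - z ∈ symmSet (imP z) := by
  have hy : imP z ∈ cone n := hz
  obtain ⟨h1, h2, h3, h4⟩ := hw
  refine ⟨?_, ?_, ?_, ?_⟩
  · convert add_mem_cone h1 (smul_mem_cone (t := 3 / 2) (by norm_num) hy) using 1
    rw [imP_sub]; module
  · convert add_mem_cone h2 hy using 1
    rw [imP_sub]; module
  · convert add_mem_cone h3 hy using 1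
    rw [reP_sub]; module
  · convert add_mem_cone h4 hy using 1
    rw [reP_sub]; module

lemma sub_mem_symmSet_right {z w : Fin n → ℂ} (hz : z ∈ tube n) (hw : w ∈ nearSet z) :
    z - w ∈ symmSet (imP w) := by
  have hy : imP z ∈ cone n := hz
  have hy' : imP w ∈ cone n := nearSet_subset_tube hz hw
  obtain ⟨h1, h2, h3, h4⟩ := hw
  have h5 := smul_mem_cone (t := 2) (by norm_num) h1
  refine ⟨?_, ?_, ?_, ?_⟩
  · convert add_mem_cone hy hy' using 1
    rw [imP_sub]; module
  · convert add_mem_cone h5 hy' using 1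
    rw [imP_sub]; module
  · convert add_mem_cone h5 h4 using 1
    rw [reP_sub]; module
  · convert add_mem_cone h5 h3 using 1
    rw [reP_sub]; module

lemma volume_nearSet_le {z : Fin n → ℂ} (hz : z ∈ tube n) : volume (nearSet z) ≤
    ENNReal.ofReal (lor (imP z) ^ n) * volume (Metric.ball (0 : Fin n → ℂ) 8) := by
  refine le_trans ?_ (volume_symmSet_le hz)
  rw [← measure_preimage_add_right volume (-z) (symmSet (imP z))]
  refine measure_mono fun w hw => ?_
  simpa [sub_eq_add_neg] using sub_mem_symmSet_left hz hw

lemma volume_nearSet_dual_le {w : Fin n → ℂ} (hw : w ∈ tube n) :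
    volume {z | z ∈ tube n ∧ w ∈ nearSet z} ≤
      ENNReal.ofReal (lor (imP w) ^ n) * volume (Metric.ball (0 : Fin n → ℂ) 8) := by
  refine le_trans ?_ (volume_symmSet_le hw)
  rw [← measure_preimage_add_right volume (-w) (symmSet (imP w))]
  refine measure_mono fun z hz => ?_
  simpa [sub_eq_add_neg] using sub_mem_symmSet_right hz.1 hz.2

lemma lor_bounds_of_mem_nearSet {z w : Fin n → ℂ} (hz : z ∈ tube n) (hw : w ∈ nearSet z) :
    lor (imP z) ≤ 4 * lor (imP w) ∧ lor (imP w) ≤ 4 * lor (imP z) := by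
  have h1 := lor_le_of_sub_mem (smul_mem_cone (t := 1 / 2) (by norm_num) hz) hw.1
  have h2 := lor_le_of_sub_mem (nearSet_subset_tube hz hw) hw.2.1
  rw [lor_smul] at h1 h2
  constructor <;> linarith

lemma lor_rpow_le_of_mem_nearSet {z w : Fin n → ℂ} (hz : z ∈ tube n) (hw : w ∈ nearSet z)
    (a : ℝ) : lor (imP z) ^ a ≤ 4 ^ |a| * lor (imP w) ^ a := by
  obtain ⟨h1, h2⟩ := lor_bounds_of_mem_nearSet hz hw
  have hz0 : 0 < lor (imP z) := hz.1
  have hw0 : 0 < lor (imP w) := (nearSet_subset_tube hz hw).1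
  rcases le_total 0 a with ha | ha
  · rw [abs_of_nonneg ha, ← Real.mul_rpow (by norm_num) hw0.le]
    exact Real.rpow_le_rpow hz0.le h1 ha
  · rw [abs_of_nonpos ha]
    have h3 : lor (imP w) / 4 ≤ lor (imP z) := by linarith
    have h4 := Real.rpow_le_rpow_of_nonpos (by positivity) h3 ha
    refine h4.trans (le_of_eq ?_)
    rw [Real.div_rpow hw0.le (by norm_num), Real.rpow_neg (by norm_num)]
    field_simp

end NearSetVolume

section WeightedEstimate

variable {n : ℕ} [NeZero n]

lemma lintegral_rpow_le_of_holder {α : Type*} [MeasurableSpace α] (μ : Measure α) {q : ℝ}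
    (hq : 1 < q) {f : α → ℝ≥0∞} (hf : AEMeasurable f μ) :
    (∫⁻ x, f x ∂μ) ^ q ≤ μ univ ^ (q - 1) * ∫⁻ x, f x ^ q ∂μ := by
  have hpq : q.HolderConjugate (q / (q - 1)) := Real.HolderConjugate.conjExponent hq
  have h := ENNReal.lintegral_mul_le_Lp_mul_Lq μ hpq hf (aemeasurable_const (b := (1 : ℝ≥0∞)))
  simp only [Pi.mul_apply, mul_one, ENNReal.one_rpow, lintegral_one] at h
  have hq0 : 0 < q := by linarith
  have h2 := ENNReal.rpow_le_rpow h hq0.le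
  rw [ENNReal.mul_rpow_of_nonneg _ _ hq0.le, ← ENNReal.rpow_mul, ← ENNReal.rpow_mul,
    one_div_mul_cancel hq0.ne', ENNReal.rpow_one, mul_comm] at h2
  convert h2 using 3
  have : q - 1 ≠ 0 := by linarith
  field_simp

lemma measurable_indicator_of_continuousOn {S : Set (Fin n → ℂ)} (hS : MeasurableSet S)
    {f : (Fin n → ℂ) → ℝ≥0∞} (hf : ContinuousOn f S) : Measurable (S.indicator f) := by
  classical
  rw [← Set.piecewise_eq_indicator]
  exact hf.measurable_piecewise continuousOn_const hS

lemma continuousOn_lor_rpow (a : ℝ) :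
    ContinuousOn (fun z : Fin n → ℂ => lor (imP z) ^ a) (tube n) := by
  refine ContinuousOn.rpow_const (continuous_lor.comp continuous_imP).continuousOn fun z hz => ?_
  exact Or.inl (ne_of_gt hz.1)

lemma exists_local_rpow_bound (n : ℕ) [NeZero n] {q : ℝ} (hq : 1 < q) : ∃ C : ℝ≥0∞, C ≠ ⊤ ∧
    ∀ G : (Fin n → ℂ) → ℂ, DifferentiableOn ℂ G (tube n) → ∀ z ∈ tube n,
      ENNReal.ofReal (lor (imP z) ^ n) * ‖(lor (imP z) : ℂ) * BoxOp G z‖ₑ ^ q ≤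
        C * ∫⁻ w in nearSet z, ‖G w‖ₑ ^ q := by
  obtain ⟨C, hC, h⟩ := exists_enorm_lor_mul_BoxOp_le n
  have hq0 : 0 < q := by linarith
  set V := volume (Metric.ball (0 : Fin n → ℂ) 8) with hV
  have hVt : V ≠ ⊤ := measure_ball_lt_top.ne
  refine ⟨C ^ q * V ^ (q - 1), ENNReal.mul_ne_top (ENNReal.rpow_ne_top_of_nonneg hq0.le hC)
    (ENNReal.rpow_ne_top_of_nonneg (by linarith) hVt), fun G hG z hz => ?_⟩
  set X := ‖(lor (imP z) : ℂ) * BoxOp G z‖ₑ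
  set L := ENNReal.ofReal (lor (imP z) ^ n) with hL
  have hL0 : L ≠ 0 := (ENNReal.ofReal_pos.2 (pow_pos hz.1 n)).ne'
  have hLt : L ≠ ⊤ := ENNReal.ofReal_ne_top
  have hm : AEMeasurable (fun w => ‖G w‖ₑ) (volume.restrict (nearSet z)) :=
    ContinuousOn.aemeasurable (continuous_enorm.comp_continuousOn
      (hG.continuousOn.mono (nearSet_subset_tube hz))) (isOpen_nearSet z).measurableSet
  have h1 := ENNReal.rpow_le_rpow (h G hG z hz) hq0.le
  rw [ENNReal.mul_rpow_of_nonneg _ _ hq0.le, ENNReal.mul_rpow_of_nonneg _ _ hq0.le] at h1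
  have h2 := lintegral_rpow_le_of_holder (volume.restrict (nearSet z)) hq hm
  rw [Measure.restrict_apply_univ] at h2
  have h3 : volume (nearSet z) ^ (q - 1) ≤ L ^ (q - 1) * V ^ (q - 1) := by
    rw [← ENNReal.mul_rpow_of_nonneg _ _ (by linarith)]
    exact ENNReal.rpow_le_rpow (volume_nearSet_le hz) (by linarith)
  have h4 : L ^ q = L ^ (q - 1) * L := by
    conv_rhs => rw [← ENNReal.rpow_one L, ← ENNReal.rpow_mul, ← ENNReal.rpow_add _ _ hL0 hLt]
    simp
  have h5 : L ^ (q - 1) * (L * X ^ q) ≤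
      L ^ (q - 1) * (C ^ q * V ^ (q - 1) * ∫⁻ w in nearSet z, ‖G w‖ₑ ^ q) := by
    calc L ^ (q - 1) * (L * X ^ q) = L ^ q * X ^ q := by rw [h4]; ring
      _ ≤ C ^ q * (∫⁻ w in nearSet z, ‖G w‖ₑ) ^ q := h1
      _ ≤ C ^ q * ((L ^ (q - 1) * V ^ (q - 1)) * ∫⁻ w in nearSet z, ‖G w‖ₑ ^ q) := by
        gcongr
        exact h2.trans (by gcongr)
      _ = _ := by ring
  rwa [ENNReal.mul_le_mul_iff_right] at h5
  · exact fun h0 => hL0 ((ENNReal.rpow_eq_zero_iff_of_pos (by linarith)).1 h0)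
  · exact ENNReal.rpow_ne_top_of_nonneg (by linarith) hLt

/-- `G ↦ Δ(Im z) □G` is bounded on every weighted `L^q` space of holomorphic functions. -/
theorem exists_lintegral_BoxOp_le (n : ℕ) [NeZero n] {q : ℝ} (hq : 1 < q) (a : ℝ) :
    ∃ C : ℝ≥0∞, C ≠ ⊤ ∧ ∀ G : (Fin n → ℂ) → ℂ, DifferentiableOn ℂ G (tube n) →
      ∫⁻ z in tube n, ‖(lor (imP z) : ℂ) * BoxOp G z‖ₑ ^ q * ENNReal.ofReal (lor (imP z) ^ a) ≤
        C * ∫⁻ z in tube n, ‖G z‖ₑ ^ q * ENNReal.ofReal (lor (imP z) ^ a) := by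
  obtain ⟨C, hC, h⟩ := exists_local_rpow_bound n hq
  have hq0 : 0 < q := by linarith
  set V := volume (Metric.ball (0 : Fin n → ℂ) 8) with hV
  have hVt : V ≠ ⊤ := measure_ball_lt_top.ne
  set b : ℝ := a - n with hb
  set D := ENNReal.ofReal (4 ^ |b|) with hD
  refine ⟨C * D * V, ENNReal.mul_ne_top (ENNReal.mul_ne_top hC ENNReal.ofReal_ne_top) hVt,
    fun G hG => ?_⟩
  have htm : MeasurableSet (tube n) := isOpen_tube.measurableSet
  set Φ : (Fin n → ℂ) → ℝ≥0∞ :=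
    (tube n).indicator (fun w => ‖G w‖ₑ ^ q * ENNReal.ofReal (lor (imP w) ^ b)) with hΦ
  have hΦm : Measurable Φ := by
    have : Φ = fun w => (tube n).indicator (fun w => ‖G w‖ₑ ^ q) w *
        (tube n).indicator (fun w => ENNReal.ofReal (lor (imP w) ^ b)) w := by
      ext w
      by_cases hw : w ∈ tube n <;> simp [hΦ, hw]
    rw [this]
    refine (measurable_indicator_of_continuousOn htm ?_).mul
      (measurable_indicator_of_continuousOn htm ?_)
    · exact (ENNReal.continuous_rpow_const).comp_continuousOn
        (continuous_enorm.comp_continuousOn hG.continuousOn)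
    · exact ENNReal.continuous_ofReal.comp_continuousOn (continuousOn_lor_rpow b)
  set E : Set ((Fin n → ℂ) × (Fin n → ℂ)) := {p | p.1 ∈ tube n ∧ p.2 ∈ nearSet p.1} with hE
  have hEm : MeasurableSet E :=
    ((isOpen_tube.preimage continuous_fst).inter isOpen_nearSet_prod).measurableSet
  have hpt : ∀ z ∈ tube n,
      ‖(lor (imP z) : ℂ) * BoxOp G z‖ₑ ^ q * ENNReal.ofReal (lor (imP z) ^ a) ≤
        C * D * ∫⁻ w, E.indicator (fun p => Φ p.2) (z, w) := by
    intro z hz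
    have hl : 0 < lor (imP z) := hz.1
    have h1 : ENNReal.ofReal (lor (imP z) ^ a) =
        ENNReal.ofReal (lor (imP z) ^ b) * ENNReal.ofReal (lor (imP z) ^ n) := by
      rw [← ENNReal.ofReal_mul (by positivity), ← Real.rpow_natCast, ← Real.rpow_add hl, hb]
      simp
    have h2 : ∫⁻ w, E.indicator (fun p => Φ p.2) (z, w) = ∫⁻ w in nearSet z, Φ w := by
      rw [← lintegral_indicator (isOpen_nearSet z).measurableSet]
      refine lintegral_congr fun w => ?_
      by_cases hw : w ∈ nearSet z <;> simp [hE, hz, hw]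
    rw [h2]
    calc _ = ENNReal.ofReal (lor (imP z) ^ b) * (ENNReal.ofReal (lor (imP z) ^ n) *
          ‖(lor (imP z) : ℂ) * BoxOp G z‖ₑ ^ q) := by rw [h1]; ring
      _ ≤ ENNReal.ofReal (lor (imP z) ^ b) * (C * ∫⁻ w in nearSet z, ‖G w‖ₑ ^ q) := by
          exact mul_le_mul_right (h G hG z hz) _
      _ = C * ∫⁻ w in nearSet z, ENNReal.ofReal (lor (imP z) ^ b) * ‖G w‖ₑ ^ q := by
          rw [lintegral_const_mul' _ _ ENNReal.ofReal_ne_top]; ring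
      _ ≤ C * ∫⁻ w in nearSet z, D * Φ w := by
          gcongr 1
          refine setLIntegral_mono' (isOpen_nearSet z).measurableSet fun w hw => ?_
          have hwt := nearSet_subset_tube hz hw
          have h3 := ENNReal.ofReal_le_ofReal (lor_rpow_le_of_mem_nearSet hz hw b)
          rw [ENNReal.ofReal_mul (by positivity)] at h3
          simp only [hΦ, indicator_of_mem hwt]
          calc _ ≤ D * ENNReal.ofReal (lor (imP w) ^ b) * ‖G w‖ₑ ^ q := by gcongr
            _ = _ := by ring
      _ = C * D * ∫⁻ w in nearSet z, Φ w := by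
          rw [lintegral_const_mul' _ _ ENNReal.ofReal_ne_top]; ring
  calc _ ≤ ∫⁻ z in tube n, C * D * ∫⁻ w, E.indicator (fun p => Φ p.2) (z, w) :=
        setLIntegral_mono' htm hpt
    _ ≤ ∫⁻ z, C * D * ∫⁻ w, E.indicator (fun p => Φ p.2) (z, w) := setLIntegral_le_lintegral _ _
    _ = C * D * ∫⁻ z, ∫⁻ w, E.indicator (fun p => Φ p.2) (z, w) :=
        lintegral_const_mul' _ _ (ENNReal.mul_ne_top hC ENNReal.ofReal_ne_top)
    _ = C * D * ∫⁻ w, ∫⁻ z, E.indicator (fun p => Φ p.2) (z, w) := by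
        rw [lintegral_lintegral_swap]
        exact ((hΦm.comp measurable_snd).indicator hEm).aemeasurable
    _ ≤ C * D * ∫⁻ w, (tube n).indicator
          (fun w => V * (‖G w‖ₑ ^ q * ENNReal.ofReal (lor (imP w) ^ a))) w := by
        gcongr with w
        have h1 : ∀ z, E.indicator (fun p => Φ p.2) (z, w) =
            {z | z ∈ tube n ∧ w ∈ nearSet z}.indicator (fun _ => Φ w) z := fun z => by
          by_cases hz : z ∈ tube n ∧ w ∈ nearSet z <;> simp [hE, hz]
        have hm : MeasurableSet {z : Fin n → ℂ | z ∈ tube n ∧ w ∈ nearSet z} :=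
          (by fun_prop : Measurable fun z : Fin n → ℂ => (z, w)) hEm
        rw [lintegral_congr h1, lintegral_indicator_const hm]
        by_cases hw : w ∈ tube n
        · have hl : 0 < lor (imP w) := hw.1
          have h2 : ENNReal.ofReal (lor (imP w) ^ a) =
              ENNReal.ofReal (lor (imP w) ^ b) * ENNReal.ofReal (lor (imP w) ^ n) := by
            rw [← ENNReal.ofReal_mul (by positivity), ← Real.rpow_natCast, ← Real.rpow_add hl, hb]
            simp
          simp only [hΦ, indicator_of_mem hw]
          rw [h2]
          calc _ ≤ ‖G w‖ₑ ^ q * ENNReal.ofReal (lor (imP w) ^ b) *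
                (ENNReal.ofReal (lor (imP w) ^ n) * V) := by
                gcongr; exact volume_nearSet_dual_le hw
            _ = _ := by ring
        · simp [hΦ, hw]
    _ = C * D * V * ∫⁻ z in tube n, ‖G z‖ₑ ^ q * ENNReal.ofReal (lor (imP z) ^ a) := by
        rw [lintegral_indicator htm, lintegral_const_mul' _ _ hVt]; ring

end WeightedEstimate

section IterateBounds

variable {n : ℕ} [NeZero n]

lemma enorm_ofReal_pow_mul_rpow {l : ℝ} (hl : 0 < l) (k : ℕ) (x : ℂ) {q : ℝ} (hq : 0 ≤ q) (b : ℝ) :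
    ‖(l : ℂ) ^ k * x‖ₑ ^ q * ENNReal.ofReal (l ^ b) =
      ‖x‖ₑ ^ q * ENNReal.ofReal (l ^ (b + k * q)) := by
  have h1 : ‖(l : ℂ) ^ k‖ₑ ^ q = ENNReal.ofReal (l ^ (k * q)) := by
    rw [← ofReal_norm, norm_pow, norm_real, Real.norm_eq_abs, abs_of_pos hl,
      ENNReal.ofReal_rpow_of_pos (by positivity), Real.rpow_mul hl.le, Real.rpow_natCast]
  rw [enorm_mul, ENNReal.mul_rpow_of_nonneg _ _ hq, h1, Real.rpow_add hl,
    ENNReal.ofReal_mul (by positivity)]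
  ring

lemma lintegral_BoxOp_iterate_lt_top {G : (Fin n → ℂ) → ℂ} (hG : DifferentiableOn ℂ G (tube n))
    {q : ℝ} (hq : 1 < q) (b : ℝ)
    (hfin : ∫⁻ z in tube n, ‖G z‖ₑ ^ q * ENNReal.ofReal (lor (imP z) ^ b) < ⊤) (k : ℕ) :
    ∫⁻ z in tube n, ‖(lor (imP z) : ℂ) ^ k * BoxOp^[k] G z‖ₑ ^ q *
      ENNReal.ofReal (lor (imP z) ^ b) < ⊤ := by
  have htm : MeasurableSet (tube n) := isOpen_tube.measurableSet
  have hq0 : 0 ≤ q := by linarith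
  induction k with
  | zero => simpa using hfin
  | succ k ih =>
    obtain ⟨C, hC, h⟩ := exists_lintegral_BoxOp_le n hq (b + k * q)
    have h1 := h _ (differentiableOn_BoxOp_iterate isOpen_tube hG k)
    refine lt_of_le_of_lt (le_of_eq ?_)
      (lt_of_le_of_lt h1 (ENNReal.mul_lt_top hC.lt_top (lt_of_eq_of_lt ?_ ih)))
    · refine setLIntegral_congr_fun htm fun z hz => ?_
      have hl : 0 < lor (imP z) := hz.1
      rw [← enorm_ofReal_pow_mul_rpow hl k _ hq0, Function.iterate_succ_apply', pow_succ, mul_assoc]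
    · refine setLIntegral_congr_fun htm fun z hz => ?_
      have hl : 0 < lor (imP z) := hz.1
      rw [enorm_ofReal_pow_mul_rpow hl k _ hq0]

lemma exists_enorm_BoxOp_iterate_le {G : (Fin n → ℂ) → ℂ} (hG : DifferentiableOn ℂ G (tube n))
    {M : ℝ≥0∞} (hM : M ≠ ⊤) (hb : ∀ z ∈ tube n, ‖G z‖ₑ ≤ M) (k : ℕ) :
    ∃ C : ℝ≥0∞, C ≠ ⊤ ∧ ∀ z ∈ tube n, ‖(lor (imP z) : ℂ) ^ k * BoxOp^[k] G z‖ₑ ≤ C := by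
  induction k with
  | zero => exact ⟨M, hM, by simpa using hb⟩
  | succ k ih =>
    obtain ⟨M', hM', ih⟩ := ih
    obtain ⟨C, hC, h⟩ := exists_enorm_lor_mul_BoxOp_le n
    set V := volume (Metric.ball (0 : Fin n → ℂ) 8) with hV
    have hVt : V ≠ ⊤ := measure_ball_lt_top.ne
    refine ⟨C * (4 ^ k * M') * V, ENNReal.mul_ne_top (ENNReal.mul_ne_top hC
      (ENNReal.mul_ne_top (by simp) hM')) hVt, fun z hz => ?_⟩
    have hl : 0 < lor (imP z) := hz.1
    have h1 := h _ (differentiableOn_BoxOp_iterate isOpen_tube hG k) z hz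
    set L := ENNReal.ofReal (lor (imP z) ^ n) with hL
    have hL0 : L ≠ 0 := (ENNReal.ofReal_pos.2 (pow_pos hz.1 n)).ne'
    have hLt : L ≠ ⊤ := ENNReal.ofReal_ne_top
    have hk : ‖(lor (imP z) : ℂ) ^ k‖ₑ ≠ ⊤ := enorm_ne_top
    have h2 : ‖(lor (imP z) : ℂ) ^ k‖ₑ * ∫⁻ w in nearSet z, ‖BoxOp^[k] G w‖ₑ ≤
        (4 ^ k * M') * (L * V) := by
      rw [← lintegral_const_mul' _ _ hk]
      calc _ ≤ ∫⁻ w in nearSet z, 4 ^ k * M' := by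
            refine setLIntegral_mono' (isOpen_nearSet z).measurableSet fun w hw => ?_
            have hwt := nearSet_subset_tube hz hw
            have hlw : 0 < lor (imP w) := hwt.1
            have h3 : ‖(lor (imP z) : ℂ) ^ k‖ₑ ≤ 4 ^ k * ‖(lor (imP w) : ℂ) ^ k‖ₑ := by
              have : (4 : ℝ≥0∞) ^ k = ‖(4 : ℂ) ^ k‖ₑ := by
                rw [← ofReal_norm, norm_pow, RCLike.norm_ofNat, ENNReal.ofReal_pow (by norm_num)]
                simp
              rw [this, ← enorm_mul, ← mul_pow, ← ofReal_norm, ← ofReal_norm]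
              refine ENNReal.ofReal_le_ofReal ?_
              rw [norm_pow, norm_pow, norm_mul, norm_real, norm_real, RCLike.norm_ofNat,
                Real.norm_eq_abs, Real.norm_eq_abs, abs_of_pos hl, abs_of_pos hlw]
              exact pow_le_pow_left₀ hl.le (lor_bounds_of_mem_nearSet hz hw).1 k
            have h4 := ih w hwt
            rw [enorm_mul] at h4
            calc _ ≤ 4 ^ k * ‖(lor (imP w) : ℂ) ^ k‖ₑ * ‖BoxOp^[k] G w‖ₑ := by gcongr
              _ ≤ _ := by rw [mul_assoc]; gcongr
        _ = (4 ^ k * M') * volume (nearSet z) := by rw [setLIntegral_const]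
        _ ≤ _ := by gcongr; exact volume_nearSet_le hz
    have h5 : L * ‖(lor (imP z) : ℂ) ^ (k + 1) * BoxOp^[k + 1] G z‖ₑ ≤
        L * (C * (4 ^ k * M') * V) := by
      rw [Function.iterate_succ_apply', pow_succ, mul_assoc, enorm_mul]
      calc _ = ‖(lor (imP z) : ℂ) ^ k‖ₑ * (L * ‖(lor (imP z) : ℂ) * BoxOp (BoxOp^[k] G) z‖ₑ) := by
            ring
        _ ≤ ‖(lor (imP z) : ℂ) ^ k‖ₑ * (C * ∫⁻ w in nearSet z, ‖BoxOp^[k] G w‖ₑ) := by gcongr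
        _ = C * (‖(lor (imP z) : ℂ) ^ k‖ₑ * ∫⁻ w in nearSet z, ‖BoxOp^[k] G w‖ₑ) := by ring
        _ ≤ C * ((4 ^ k * M') * (L * V)) := by gcongr
        _ = _ := by ring
    rwa [ENNReal.mul_le_mul_iff_right hL0 hLt] at h5

end IterateBounds

section Pairing

variable {n : ℕ} [NeZero n]

lemma measurable_lor_imP_rpow (a : ℝ) : Measurable fun z : Fin n → ℂ => lor (imP z) ^ a :=
  (continuous_lor.comp continuous_imP).measurable.pow_const a

lemma measurable_weight (a : ℝ) :
    Measurable fun z : Fin n → ℂ => ENNReal.ofReal (lor (imP z) ^ a) :=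
  (measurable_lor_imP_rpow a).ennreal_ofReal

lemma lintegral_dV (ν : ℝ) (g : (Fin n → ℂ) → ℝ≥0∞) :
    ∫⁻ z, g z ∂(dV n ν) =
      ∫⁻ z in tube n, g z * ENNReal.ofReal (lor (imP z) ^ (ν - (n : ℝ) / 2)) := by
  rw [dV, lintegral_withDensity_eq_lintegral_mul_non_measurable _ (measurable_weight _)
    (Filter.Eventually.of_forall fun _ => ENNReal.ofReal_lt_top)]
  exact lintegral_congr fun z => mul_comm _ _

lemma integrable_dV_iff (ν : ℝ) (f : (Fin n → ℂ) → ℂ) : Integrable f (dV n ν) ↔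
    IntegrableOn (fun z => ((lor (imP z) ^ (ν - (n : ℝ) / 2) : ℝ) : ℂ) * f z) (tube n) := by
  rw [dV, integrable_withDensity_iff_integrable_smul' (measurable_weight _)
    (Filter.Eventually.of_forall fun _ => ENNReal.ofReal_lt_top), IntegrableOn]
  refine integrable_congr ?_
  filter_upwards [ae_restrict_mem isOpen_tube.measurableSet] with z hz
  have hl : 0 < lor (imP z) := hz.1
  rw [ENNReal.toReal_ofReal (by positivity), real_smul]

lemma integral_dV (ν : ℝ) (f : (Fin n → ℂ) → ℂ) : ∫ z, f z ∂(dV n ν) =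
    ∫ z in tube n, ((lor (imP z) ^ (ν - (n : ℝ) / 2) : ℝ) : ℂ) * f z := by
  rw [dV, integral_withDensity_eq_integral_toReal_smul (measurable_weight _)
    (Filter.Eventually.of_forall fun _ => ENNReal.ofReal_lt_top)]
  refine setIntegral_congr_fun isOpen_tube.measurableSet fun z hz => ?_
  have hl : 0 < lor (imP z) := hz.1
  rw [ENNReal.toReal_ofReal (by positivity), real_smul]

lemma aestronglyMeasurable_dV {f : (Fin n → ℂ) → ℂ} (hf : ContinuousOn f (tube n)) (ν : ℝ) :
    AEStronglyMeasurable f (dV n ν) :=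
  (hf.aestronglyMeasurable isOpen_tube.measurableSet).mono_ac (withDensity_absolutelyContinuous _ _)

lemma lpInt_eq {p : ℝ} (hp : 0 ≤ p) (ν : ℝ) (F : (Fin n → ℂ) → ℂ) :
    lpInt n p ν F = ∫⁻ z, ‖F z‖ₑ ^ p ∂(dV n ν) := by
  refine lintegral_congr fun z => ?_
  rw [← ofReal_norm, ENNReal.ofReal_rpow_of_nonneg (norm_nonneg _) hp]

lemma memLp_dV {f : (Fin n → ℂ) → ℂ} (hf : ContinuousOn f (tube n)) {p ν : ℝ} (hp : 0 < p)
    (hfin : ∫⁻ z, ‖f z‖ₑ ^ p ∂(dV n ν) < ⊤) : MemLp f (ENNReal.ofReal p) (dV n ν) := by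
  refine ⟨aestronglyMeasurable_dV hf ν, ?_⟩
  rw [eLpNorm_lt_top_iff_lintegral_rpow_enorm_lt_top (ENNReal.ofReal_pos.2 hp).ne'
    ENNReal.ofReal_ne_top, ENNReal.toReal_ofReal hp.le]
  exact hfin

lemma continuousOn_pow_mul_BoxOp_iterate {G : (Fin n → ℂ) → ℂ}
    (hG : DifferentiableOn ℂ G (tube n)) (k : ℕ) :
    ContinuousOn (fun z => (lor (imP z) : ℂ) ^ k * BoxOp^[k] G z) (tube n) :=
  ((continuous_ofReal.comp (continuous_lor.comp continuous_imP)).pow k).continuousOn.mul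
    (differentiableOn_BoxOp_iterate isOpen_tube hG k).continuousOn

/-- The pairing of `F` with `Δ(Im z)^k □^k G` is absolutely convergent. -/
theorem integrable_mul_conj_BoxOp_iterate {p ν : ℝ} (hp : 1 ≤ p) {F G : (Fin n → ℂ) → ℂ}
    (hF : memA n p ν F)
    (hG : if p = 1 then DifferentiableOn ℂ G (tube n) ∧ ∃ M : ℝ, ∀ z ∈ tube n, ‖G z‖ ≤ M
       else memA n (p / (p - 1)) ν G) (k : ℕ) :
    Integrable (fun z => F z * (starRingEnd ℂ) (BoxOp^[k] G z) * ((lor (imP z) : ℂ)) ^ k)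
      (dV n ν) := by
  have hp0 : 0 < p := by linarith
  have hFint := hF.2
  rw [lpInt_eq hp0.le] at hFint
  have hFm := memLp_dV hF.1.continuousOn hp0 hFint
  have hform : ∀ z, F z * (starRingEnd ℂ) (BoxOp^[k] G z) * ((lor (imP z) : ℂ)) ^ k =
      F z * (starRingEnd ℂ) ((lor (imP z) : ℂ) ^ k * BoxOp^[k] G z) := fun z => by
    rw [map_mul, map_pow, conj_ofReal]; ring
  simp only [hform]
  split_ifs at hG with h1
  · obtain ⟨hGd, M, hM⟩ := hG
    obtain ⟨C, hC, hb⟩ := exists_enorm_BoxOp_iterate_le hGd (M := ENNReal.ofReal M)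
      ENNReal.ofReal_ne_top (fun z hz => by
        rw [← ofReal_norm]; exact ENNReal.ofReal_le_ofReal (hM z hz)) k
    subst h1
    rw [ENNReal.ofReal_one, memLp_one_iff_integrable] at hFm
    refine hFm.mul_bdd (c := C.toReal) ?_ ?_
    · exact aestronglyMeasurable_dV (continuous_conj.comp_continuousOn
        (continuousOn_pow_mul_BoxOp_iterate hGd k)) ν
    · have : ∀ᵐ z ∂(dV n ν), z ∈ tube n :=
        (withDensity_absolutelyContinuous _ _) (ae_restrict_mem isOpen_tube.measurableSet)
      filter_upwards [this] with z hz
      rw [RCLike.norm_conj, ← toReal_enorm]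
      exact ENNReal.toReal_mono hC (hb z hz)
  · have hp1 : 1 < p := lt_of_le_of_ne hp (Ne.symm h1)
    have hpq : p.HolderConjugate (p / (p - 1)) := Real.HolderConjugate.conjExponent hp1
    have hq : 1 < p / (p - 1) := hpq.symm.lt
    have hGint := hG.2
    rw [lpInt_eq (by linarith), lintegral_dV] at hGint
    have h2 := lintegral_BoxOp_iterate_lt_top hG.1 hq _ hGint k
    rw [← lintegral_dV ν (fun z => ‖(lor (imP z) : ℂ) ^ k * BoxOp^[k] G z‖ₑ ^ (p / (p - 1)))] at h2
    have hGm := memLp_dV (continuousOn_pow_mul_BoxOp_iterate hG.1 k) (by linarith) h2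
    have := hpq.ennrealOfReal
    exact hFm.integrable_mul hGm.star

end Pairing

section Dbar

variable {n : ℕ}

/-- The Wirtinger derivative `∂/∂z̄ⱼ`. -/
def dbar (j : Fin n) (u : (Fin n → ℂ) → ℂ) (z : Fin n → ℂ) : ℂ :=
  (1 / 2) * (fderiv ℝ u z (Pi.single j 1) + I * fderiv ℝ u z (Pi.single j I))

/-- `u` is real differentiable at `z` with `∂u/∂z̄ⱼ = c` there. -/
def HasDbar (j : Fin n) (u : (Fin n → ℂ) → ℂ) (c : ℂ) (z : Fin n → ℂ) : Prop :=
  DifferentiableAt ℝ u z ∧ dbar j u z = c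

variable {j : Fin n} {u v : (Fin n → ℂ) → ℂ} {c d : ℂ} {z : Fin n → ℂ}

lemma HasDbar.congr_of_eventuallyEq (h : HasDbar j u c z) (huv : v =ᶠ[nhds z] u) :
    HasDbar j v c z := by
  refine ⟨h.1.congr_of_eventuallyEq huv, ?_⟩
  rw [← h.2, dbar, dbar, huv.fderiv_eq]

lemma HasDbar.congr_val (h : HasDbar j u c z) (hcd : c = d) : HasDbar j u d z := hcd ▸ h

lemma HasDbar.add (hu : HasDbar j u c z) (hv : HasDbar j v d z) :
    HasDbar j (fun z => u z + v z) (c + d) z := by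
  refine ⟨hu.1.add hv.1, ?_⟩
  rw [← hu.2, ← hv.2, dbar, dbar, dbar, fderiv_fun_add hu.1 hv.1]
  simp only [add_apply]
  ring

lemma HasDbar.mul (hu : HasDbar j u c z) (hv : HasDbar j v d z) :
    HasDbar j (fun z => u z * v z) (u z * d + c * v z) z := by
  refine ⟨hu.1.mul hv.1, ?_⟩
  rw [← hu.2, ← hv.2, dbar, dbar, dbar, fderiv_fun_mul hu.1 hv.1]
  simp only [add_apply, smul_apply, smul_eq_mul]
  ring

lemma hasDbar_const (c : ℂ) : HasDbar j (fun _ => c) 0 z :=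
  ⟨differentiableAt_const c, by simp [dbar]⟩

lemma HasDbar.const_mul (hu : HasDbar j u c z) (a : ℂ) :
    HasDbar j (fun z => a * u z) (a * c) z :=
  ((hasDbar_const a).mul hu).congr_val (by ring)

lemma HasDbar.sub (hu : HasDbar j u c z) (hv : HasDbar j v d z) :
    HasDbar j (fun z => u z - v z) (c - d) z := by
  have := hu.add (hv.const_mul (-1))
  simpa [sub_eq_add_neg] using this

lemma HasDbar.sum {ι : Type*} {s : Finset ι} {u : ι → (Fin n → ℂ) → ℂ} {c : ι → ℂ}
    (h : ∀ i ∈ s, HasDbar j (u i) (c i) z) :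
    HasDbar j (fun z => ∑ i ∈ s, u i z) (∑ i ∈ s, c i) z := by
  classical
  induction s using Finset.induction_on with
  | empty => simpa using hasDbar_const 0
  | insert a s ha ih =>
    simp only [Finset.sum_insert ha]
    exact (h a (by simp)).add (ih fun i hi => h i (by simp [hi]))

lemma hasDbar_of_differentiableAt (hu : DifferentiableAt ℂ u z) : HasDbar j u 0 z := by
  refine ⟨hu.restrictScalars ℝ, ?_⟩
  have h : (Pi.single j I : Fin n → ℂ) = I • Pi.single j 1 := by
    rw [← Pi.single_smul]; simp
  rw [dbar, hu.fderiv_restrictScalars ℝ]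
  simp only [ContinuousLinearMap.coe_restrictScalars', h, map_smul, smul_eq_mul]
  linear_combination (1 / 2 * fderiv ℂ u z (Pi.single j 1)) * I_mul_I

lemma hasDbar_conj (hu : DifferentiableAt ℂ u z) :
    HasDbar j (fun z => (starRingEnd ℂ) (u z)) ((starRingEnd ℂ) (pd j u z)) z := by
  have hr := hu.restrictScalars ℝ
  have hf : HasFDerivAt (fun z => (starRingEnd ℂ) (u z))
      ((conjCLE : ℂ →L[ℝ] ℂ).comp (fderiv ℝ u z)) z :=
    (conjCLE : ℂ →L[ℝ] ℂ).hasFDerivAt.comp z hr.hasFDerivAt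
  refine ⟨hf.differentiableAt, ?_⟩
  have h : (Pi.single j I : Fin n → ℂ) = I • Pi.single j 1 := by
    rw [← Pi.single_smul]; simp
  rw [dbar, hf.fderiv, hu.fderiv_restrictScalars ℝ, pd]
  simp only [ContinuousLinearMap.comp_apply, ContinuousLinearMap.coe_restrictScalars', h, map_smul,
    smul_eq_mul, ContinuousLinearEquiv.coe_coe, conjCLE_apply, map_mul, conj_I]
  linear_combination (-(1 / 2) * (starRingEnd ℂ) (fderiv ℂ u z (Pi.single j 1))) * I_mul_I

lemma HasDbar.comp_real {r : (Fin n → ℂ) → ℝ} (hr : HasDbar j (fun z => (r z : ℂ)) c z)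
    {φ : ℝ → ℝ} {φ' : ℝ} (hφ : HasDerivAt φ φ' (r z)) :
    HasDbar j (fun z => (φ (r z) : ℂ)) (φ' * c) z := by
  have h1 : DifferentiableAt ℝ r z := by
    have := (reCLM.differentiableAt (x := (r z : ℂ))).comp z hr.1
    exact this
  have h2 : HasFDerivAt (fun z => (r z : ℂ)) (ofRealCLM.comp (fderiv ℝ r z)) z :=
    ofRealCLM.hasFDerivAt.comp z h1.hasFDerivAt
  have h3 : HasFDerivAt (fun z => (φ (r z) : ℂ)) (ofRealCLM.comp (φ' • fderiv ℝ r z)) z :=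
    ofRealCLM.hasFDerivAt.comp z (hφ.comp_hasFDerivAt z h1.hasFDerivAt)
  refine ⟨h3.differentiableAt, ?_⟩
  rw [← hr.2, dbar, dbar, h2.fderiv, h3.fderiv]
  simp only [ContinuousLinearMap.comp_apply, smul_apply, smul_eq_mul,
    ofRealCLM_apply, ofReal_mul]
  ring

lemma hasDbar_im (i : Fin n) :
    HasDbar j (fun z => ((imP z i : ℝ) : ℂ)) (if i = j then I / 2 else 0) z := by
  have hp : DifferentiableAt ℂ (fun z : Fin n → ℂ => z i) z := differentiableAt_apply i z
  have hpd : pd j (fun z : Fin n → ℂ => z i) z = if i = j then 1 else 0 := by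
    have : HasFDerivAt (fun z : Fin n → ℂ => z i)
      (ContinuousLinearMap.proj i : (Fin n → ℂ) →L[ℂ] ℂ) z := hasFDerivAt_apply i z
    rw [pd, this.fderiv]
    simp [Pi.single_apply]
  have h := ((hasDbar_of_differentiableAt (j := j) hp).sub (hasDbar_conj (j := j) hp)).const_mul
    (-I / 2)
  have heq : (fun z : Fin n → ℂ => ((imP z i : ℝ) : ℂ)) =
      fun z => -I / 2 * (z i - (starRingEnd ℂ) (z i)) := by
    funext w
    rw [sub_conj]
    simp only [imP]
    push_cast
    linear_combination ((w i).im : ℂ) * I_mul_I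
  rw [heq]
  refine h.congr_val ?_
  rw [hpd]
  split_ifs <;> simp; ring

end Dbar

section TestFunction

variable {n : ℕ}

lemma contDiffOn_one_of_differentiableOn {F : (Fin n → ℂ) → ℂ} {U : Set (Fin n → ℂ)}
    (hU : IsOpen U) (hF : DifferentiableOn ℂ F U) : ContDiffOn ℝ 1 F U := by
  have h : ContDiffOn ℂ (0 + 1) F U := by
    rw [contDiffOn_succ_iff_fderiv_of_isOpen hU]
    refine ⟨hF, by simp, ?_⟩
    rw [contDiffOn_zero, continuousOn_clm_apply]
    exact fun v => (differentiableOn_fderiv_apply hU hF v).continuousOn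
  rw [zero_add] at h
  exact h.restrict_scalars ℝ

lemma contDiff_dbar {k l : WithTop ℕ∞} {u : (Fin n → ℂ) → ℂ} (hu : ContDiff ℝ l u)
    (hkl : k + 1 ≤ l) (j : Fin n) : ContDiff ℝ k (dbar j u) := by
  have h : ContDiff ℝ k (fderiv ℝ u) := hu.fderiv_right hkl
  unfold dbar
  exact contDiff_const.mul ((h.clm_apply contDiff_const).add
    (contDiff_const.mul (h.clm_apply contDiff_const)))

lemma dbar_eq_zero_of_notMem {u : (Fin n → ℂ) → ℂ} {z : Fin n → ℂ} (hz : z ∉ tsupport u)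
    (j : Fin n) : dbar j u z = 0 := by
  have h : fderiv ℝ u z = 0 := by
    by_contra h0
    exact hz (support_fderiv_subset ℝ h0)
  simp [dbar, h]

lemma tsupport_dbar_subset (u : (Fin n → ℂ) → ℂ) (j : Fin n) :
    tsupport (dbar j u) ⊆ tsupport u := by
  refine closure_minimal (fun z hz => ?_) (isClosed_tsupport u)
  by_contra h
  exact hz (dbar_eq_zero_of_notMem h j)

lemma integral_fderiv_eq_zero {u : (Fin n → ℂ) → ℂ} (hu : ContDiff ℝ 1 u)
    (hc : HasCompactSupport u) (v : Fin n → ℂ) : ∫ z, fderiv ℝ u z v = 0 := by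
  have hi : Integrable (fun z => fderiv ℝ u z v) :=
    ((hu.continuous_fderiv one_ne_zero).clm_apply
      continuous_const).integrable_of_hasCompactSupport (hc.fderiv_apply ℝ v)
  have h := integral_mul_fderiv_eq_neg_fderiv_mul_of_integrable (μ := volume)
    (f := fun _ : Fin n → ℂ => (1 : ℂ)) (g := u) (v := v) (by simp) (by simpa using hi)
    (by simpa using hu.continuous.integrable_of_hasCompactSupport hc)
    (fun _ _ => differentiableAt_const _) (fun z _ => hu.differentiable one_ne_zero z)
  simpa using h

lemma integral_dbar_eq_zero {u : (Fin n → ℂ) → ℂ} (hu : ContDiff ℝ 1 u)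
    (hc : HasCompactSupport u) (j : Fin n) : ∫ z, dbar j u z = 0 := by
  have hi (v : Fin n → ℂ) : Integrable (fun z => fderiv ℝ u z v) :=
    ((hu.continuous_fderiv one_ne_zero).clm_apply
      continuous_const).integrable_of_hasCompactSupport (hc.fderiv_apply ℝ v)
  unfold dbar
  rw [integral_const_mul, integral_add (hi _) ((hi _).const_mul _), integral_const_mul,
    integral_fderiv_eq_zero hu hc, integral_fderiv_eq_zero hu hc]
  simp

variable {U : Set (Fin n → ℂ)}

lemma continuous_mul_of_tsupport_subset (hU : IsOpen U) {g ψ : (Fin n → ℂ) → ℂ}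
    (hg : ContinuousOn g U) (hψ : Continuous ψ) (hs : tsupport ψ ⊆ U) :
    Continuous (fun z => g z * ψ z) :=
  (hg.mul hψ.continuousOn).continuous_of_tsupport_subset hU
    ((tsupport_mul_subset_right (f := g) (g := ψ)).trans hs)

lemma integrable_mul_of_tsupport_subset (hU : IsOpen U) {g ψ : (Fin n → ℂ) → ℂ}
    (hg : ContinuousOn g U) (hψ : Continuous ψ) (hc : HasCompactSupport ψ)
    (hs : tsupport ψ ⊆ U) : Integrable (fun z => g z * ψ z) :=
  (continuous_mul_of_tsupport_subset hU hg hψ hs).integrable_of_hasCompactSupport hc.mul_left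

/-- Integration by parts against a test function. -/
lemma integral_mul_conj_pd_mul (hU : IsOpen U) {F H ψ : (Fin n → ℂ) → ℂ}
    (hF : DifferentiableOn ℂ F U) (hH : DifferentiableOn ℂ H U) (hψ : ContDiff ℝ 1 ψ)
    (hc : HasCompactSupport ψ) (hs : tsupport ψ ⊆ U) (j : Fin n) :
    ∫ z, F z * (starRingEnd ℂ) (pd j H z) * ψ z =
      -∫ z, F z * (starRingEnd ℂ) (H z) * dbar j ψ z := by
  set u : (Fin n → ℂ) → ℂ := fun z => F z * (starRingEnd ℂ) (H z) * ψ z with hu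
  have hsupp : tsupport u ⊆ tsupport ψ :=
    tsupport_mul_subset_right (f := fun z => F z * (starRingEnd ℂ) (H z)) (g := ψ)
  have huc : HasCompactSupport u := hc.mul_left
  have hu1 : ContDiff ℝ 1 u := by
    refine contDiff_of_contDiffOn_union_of_isOpen (s := U) (t := (tsupport u)ᶜ) ?_ ?_ ?_ hU
      (isClosed_tsupport u).isOpen_compl
    · exact ((contDiffOn_one_of_differentiableOn hU hF).mul
        ((conjCLE : ℂ →L[ℝ] ℂ).contDiff.comp_contDiffOn
          (contDiffOn_one_of_differentiableOn hU hH))).mul hψ.contDiffOn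
    · exact (contDiffOn_const (c := (0 : ℂ))).congr fun z hz => image_eq_zero_of_notMem_tsupport hz
    · rw [Set.eq_univ_iff_forall]
      intro z
      by_cases hz : z ∈ U
      · exact Or.inl hz
      · exact Or.inr fun h => hz (hs (hsupp h))
  have hd : ∀ z, dbar j u z = F z * (starRingEnd ℂ) (pd j H z) * ψ z +
      F z * (starRingEnd ℂ) (H z) * dbar j ψ z := by
    intro z
    by_cases hz : z ∈ U
    · have h1 := ((hasDbar_of_differentiableAt (j := j) (hF.differentiableAt (hU.mem_nhds hz))).mul
        (hasDbar_conj (hH.differentiableAt (hU.mem_nhds hz)))).mul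
        (v := ψ) ⟨hψ.differentiable one_ne_zero z, rfl⟩
      rw [h1.2]
      ring
    · have hz' : z ∉ tsupport ψ := fun h => hz (hs h)
      rw [dbar_eq_zero_of_notMem (fun h => hz' (hsupp h)), dbar_eq_zero_of_notMem hz',
        image_eq_zero_of_notMem_tsupport hz']
      ring
  have hcont {K : (Fin n → ℂ) → ℂ} (hK : DifferentiableOn ℂ K U) :
      ContinuousOn (fun z => F z * (starRingEnd ℂ) (K z)) U :=
    hF.continuousOn.mul (continuous_conj.comp_continuousOn hK.continuousOn)
  have hdψ : Continuous (dbar j ψ) := (contDiff_dbar (k := 0) hψ (by simp) j).continuous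
  have h0 := integral_dbar_eq_zero hu1 huc j
  simp_rw [hd] at h0
  rw [integral_add
    (integrable_mul_of_tsupport_subset hU (hcont (differentiableOn_pd hU hH j)) hψ.continuous hc hs)
    (integrable_mul_of_tsupport_subset hU (hcont hH) hdψ
      (hc.mono' ((subset_tsupport _).trans (tsupport_dbar_subset ψ j)))
      ((tsupport_dbar_subset ψ j).trans hs))] at h0
  exact eq_neg_of_add_eq_zero_left h0

lemma integral_mul_conj_pd_pd_mul (hU : IsOpen U) {F H ψ : (Fin n → ℂ) → ℂ}
    (hF : DifferentiableOn ℂ F U) (hH : DifferentiableOn ℂ H U) (hψ : ContDiff ℝ 2 ψ)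
    (hc : HasCompactSupport ψ) (hs : tsupport ψ ⊆ U) (j : Fin n) :
    ∫ z, F z * (starRingEnd ℂ) (pd j (pd j H) z) * ψ z =
      ∫ z, F z * (starRingEnd ℂ) (H z) * dbar j (dbar j ψ) z := by
  rw [integral_mul_conj_pd_mul hU hF (differentiableOn_pd hU hH j) (hψ.of_le one_le_two) hc hs,
    integral_mul_conj_pd_mul hU hF hH (contDiff_dbar hψ (by rfl) j)
      (hc.mono' ((subset_tsupport _).trans (tsupport_dbar_subset ψ j)))
      ((tsupport_dbar_subset ψ j).trans hs), neg_neg]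

/-- The second order operator `□̄ = 2∂̄₀² - ∑ ∂̄ⱼ²`. -/
def waveBar [NeZero n] (ψ : (Fin n → ℂ) → ℂ) (z : Fin n → ℂ) : ℂ :=
  2 * dbar 0 (dbar 0 ψ) z - ∑ j, dbar j (dbar j ψ) z

lemma integral_mul_conj_BoxOp_mul [NeZero n] (hU : IsOpen U) {F H ψ : (Fin n → ℂ) → ℂ}
    (hF : DifferentiableOn ℂ F U) (hH : DifferentiableOn ℂ H U) (hψ : ContDiff ℝ 2 ψ)
    (hc : HasCompactSupport ψ) (hs : tsupport ψ ⊆ U) :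
    ∫ z, F z * (starRingEnd ℂ) (BoxOp H z) * ψ z =
      -∫ z, F z * (starRingEnd ℂ) (H z) * waveBar ψ z := by
  have hcont {K : (Fin n → ℂ) → ℂ} (hK : DifferentiableOn ℂ K U) :
      ContinuousOn (fun z => F z * (starRingEnd ℂ) (K z)) U :=
    hF.continuousOn.mul (continuous_conj.comp_continuousOn hK.continuousOn)
  have hi1 (j : Fin n) : Integrable (fun z => F z * (starRingEnd ℂ) (pd j (pd j H) z) * ψ z) :=
    integrable_mul_of_tsupport_subset hU
      (hcont (differentiableOn_pd hU (differentiableOn_pd hU hH j) j)) hψ.continuous hc hs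
  have hi2 (j : Fin n) :
      Integrable (fun z => F z * (starRingEnd ℂ) (H z) * dbar j (dbar j ψ) z) := by
    have hsub : tsupport (dbar j (dbar j ψ)) ⊆ tsupport ψ :=
      (tsupport_dbar_subset _ j).trans (tsupport_dbar_subset ψ j)
    exact integrable_mul_of_tsupport_subset hU (hcont hH)
      (contDiff_dbar (k := 0) (contDiff_dbar (k := 1) hψ (by rfl) j) (by simp) j).continuous
      (hc.mono' ((subset_tsupport _).trans hsub)) (hsub.trans hs)
  have e1 : ∀ z, F z * (starRingEnd ℂ) (BoxOp H z) * ψ z =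
      (∑ j, F z * (starRingEnd ℂ) (pd j (pd j H) z) * ψ z) -
      2 * (F z * (starRingEnd ℂ) (pd 0 (pd 0 H) z) * ψ z) := by
    intro z
    simp only [BoxOp, map_neg, map_sub, map_mul, map_sum, map_ofNat, ← Finset.mul_sum,
      ← Finset.sum_mul]
    ring
  have e2 : ∀ z, F z * (starRingEnd ℂ) (H z) * waveBar ψ z =
      2 * (F z * (starRingEnd ℂ) (H z) * dbar 0 (dbar 0 ψ) z) -
      ∑ j, F z * (starRingEnd ℂ) (H z) * dbar j (dbar j ψ) z := by
    intro z
    simp only [waveBar, ← Finset.mul_sum]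
    ring
  simp_rw [e1, e2]
  rw [integral_sub (integrable_finsetSum _ fun j _ => hi1 j) ((hi1 0).const_mul 2),
    integral_sub ((hi2 0).const_mul 2) (integrable_finsetSum _ fun j _ => hi2 j),
    integral_finsetSum _ fun j _ => hi1 j, integral_finsetSum _ fun j _ => hi2 j,
    integral_const_mul, integral_const_mul]
  simp_rw [integral_mul_conj_pd_pd_mul hU hF hH hψ hc hs]
  ring

end TestFunction

section Cutoff

variable {n : ℕ} [NeZero n]

/-- The diagonal signs of the Lorentz form. -/
def lorSign (j : Fin n) : ℂ := if j = 0 then 1 else -1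

lemma lorSign_eq_or (j : Fin n) : lorSign j = 1 ∨ lorSign j = -1 := by
  unfold lorSign; split_ifs <;> simp

lemma two_mul_sub_sum (X : Fin n → ℂ) : 2 * X 0 - ∑ j, X j = ∑ j, lorSign j * X j := by
  have h : ∀ j, lorSign j * X j = (if j = 0 then 2 * X j else 0) - X j := by
    intro j; unfold lorSign; split_ifs <;> ring
  simp_rw [h, Finset.sum_sub_distrib]
  simp

lemma sum_lorSign_im (z : Fin n → ℂ) :
    ∑ j, lorSign j * ((imP z j : ℝ) : ℂ) ^ 2 = (lor (imP z) : ℂ) := by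
  rw [← two_mul_sub_sum (fun j => ((imP z j : ℝ) : ℂ) ^ 2)]
  simp [lor]

/-- The translate of `z` by `i` times the base point of the cone. -/
def shiftE (z : Fin n → ℂ) : Fin n → ℂ := z + I • toC (baseE n)

lemma imP_shiftE (z : Fin n → ℂ) : imP (shiftE z) = imP z + baseE n := by
  rw [shiftE, imP_add_smul_toC]; simp

lemma shiftE_mem {z : Fin n → ℂ} (hz : z ∈ tube n) : shiftE z ∈ tube n := by
  change imP (shiftE z) ∈ cone n
  rw [imP_shiftE]
  exact add_mem_cone hz baseE_mem

/-- The Lorentz form of the translated point. -/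
def lorShift (z : Fin n → ℂ) : ℂ := lorC (shiftE z)

lemma lorShift_ne_zero {z : Fin n → ℂ} (hz : z ∈ tube n) : lorShift z ≠ 0 :=
  lorC_ne_zero (shiftE_mem hz)

lemma sum_lorSign_conj_shiftE_mul (z : Fin n → ℂ) :
    ∑ j, lorSign j * ((starRingEnd ℂ) (shiftE z j) * ((imP z j : ℝ) : ℂ)) =
      (starRingEnd ℂ) (lorBilC (shiftE z) (toC (imP z))) := by
  rw [← two_mul_sub_sum (fun j => (starRingEnd ℂ) (shiftE z j) * ((imP z j : ℝ) : ℂ))]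
  simp [lorBilC, toC, conj_ofNat]

lemma sum_lorSign_conj_shiftE_sq (z : Fin n → ℂ) :
    ∑ j, lorSign j * (starRingEnd ℂ) (shiftE z j) ^ 2 = (starRingEnd ℂ) (lorShift z) := by
  rw [← two_mul_sub_sum (fun j => (starRingEnd ℂ) (shiftE z j) ^ 2)]
  simp [lorShift, lorC, conj_ofNat]

/-- Comparison of the shifted determinant with the height; a proper function on the tube. -/
def heightLog (z : Fin n → ℂ) : ℝ := Real.log (normSq (lorShift z)) - Real.log (lor (imP z))

variable {j : Fin n} {z : Fin n → ℂ}

lemma hasDbar_conj_shiftE (i : Fin n) :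
    HasDbar j (fun z => (starRingEnd ℂ) (shiftE z i)) (if i = j then 1 else 0) z := by
  have hf : HasFDerivAt (fun z : Fin n → ℂ => shiftE z i)
      (ContinuousLinearMap.proj i : (Fin n → ℂ) →L[ℂ] ℂ) z :=
    (hasFDerivAt_apply (𝕜 := ℂ) i z).add_const _
  refine (hasDbar_conj hf.differentiableAt).congr_val ?_
  rw [pd, hf.fderiv]
  by_cases h : i = j <;> simp [h]

lemma hasDbar_conj_lorShift :
    HasDbar j (fun z => (starRingEnd ℂ) (lorShift z))
      (2 * lorSign j * (starRingEnd ℂ) (shiftE z j)) z := by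
  have h := HasDbar.sum (s := Finset.univ) fun i _ =>
    ((hasDbar_conj_shiftE (j := j) (z := z) i).mul (hasDbar_conj_shiftE i)).const_mul (lorSign i)
  simp_rw [← sum_lorSign_conj_shiftE_sq, sq]
  refine h.congr_val ?_
  rw [Finset.sum_eq_single j (fun i _ hi => by simp [hi]) (by simp), if_pos rfl]
  ring

lemma hasDbar_lorShift : HasDbar j (fun z => lorShift (n := n) z) 0 z := by
  refine hasDbar_of_differentiableAt ?_
  unfold lorShift lorC shiftE
  fun_prop

lemma hasDbar_lor_imP :
    HasDbar j (fun z => ((lor (imP z) : ℝ) : ℂ)) (I * lorSign j * ((imP z j : ℝ) : ℂ)) z := by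
  have h := HasDbar.sum (s := Finset.univ) fun i _ =>
    ((hasDbar_im (j := j) (z := z) i).mul (hasDbar_im i)).const_mul (lorSign i)
  simp_rw [← sum_lorSign_im, sq]
  refine h.congr_val ?_
  rw [Finset.sum_eq_single j (fun i _ hi => by simp [hi]) (by simp), if_pos rfl]
  ring

lemma hasDbar_heightLog (hz : z ∈ tube n) :
    HasDbar j (fun z => ((heightLog z : ℝ) : ℂ))
      (2 * lorSign j * (starRingEnd ℂ) (shiftE z j) / (starRingEnd ℂ) (lorShift z) -
        I * lorSign j * ((imP z j : ℝ) : ℂ) / (lor (imP z) : ℂ)) z := by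
  have hb := lorShift_ne_zero hz
  have hb' : (starRingEnd ℂ) (lorShift z) ≠ 0 := by simpa using hb
  have ha : ((lor (imP z) : ℝ) : ℂ) ≠ 0 := by exact_mod_cast hz.1.ne'
  have h1 : HasDbar j (fun z => ((normSq (lorShift z) : ℝ) : ℂ))
      (lorShift z * (2 * lorSign j * (starRingEnd ℂ) (shiftE z j))) z := by
    simp_rw [← mul_conj]
    exact (hasDbar_lorShift.mul hasDbar_conj_lorShift).congr_val (by ring)
  have h2 := h1.comp_real (Real.hasDerivAt_log (normSq_pos.2 hb).ne')
  have h3 := (hasDbar_lor_imP (j := j) (z := z)).comp_real (Real.hasDerivAt_log hz.1.ne')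
  have h4 := h2.sub h3
  unfold heightLog
  simp only [ofReal_sub]
  refine h4.congr_val ?_
  push_cast
  rw [← mul_conj]
  field_simp

lemma hasDbar_conj_shiftE_div (hz : z ∈ tube n) :
    HasDbar j (fun z => (starRingEnd ℂ) (shiftE z j) / (starRingEnd ℂ) (lorShift z))
      (1 / (starRingEnd ℂ) (lorShift z) -
        2 * lorSign j * (starRingEnd ℂ) (shiftE z j) ^ 2 / (starRingEnd ℂ) (lorShift z) ^ 2) z := by
  have hb := lorShift_ne_zero hz
  have hb' : (starRingEnd ℂ) (lorShift z) ≠ 0 := by simpa using hb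
  have hd : DifferentiableAt ℂ (fun z => 1 / lorShift (n := n) z) z := by
    have : DifferentiableAt ℂ (fun z => lorShift (n := n) z) z := by
      unfold lorShift lorC shiftE
      fun_prop
    simpa only [one_div] using this.fun_inv hb
  have h1 := hasDbar_conj (j := j) hd
  have h2 := h1.mul (hasDbar_conj_lorShift (j := j) (z := z))
  have h3 : HasDbar j (fun z => (starRingEnd ℂ) (1 / lorShift z) * (starRingEnd ℂ) (lorShift z))
      0 z := by
    refine (hasDbar_const 1).congr_of_eventuallyEq ?_
    filter_upwards [isOpen_tube.mem_nhds hz] with w hw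
    rw [← map_mul, one_div_mul_cancel (lorShift_ne_zero hw), map_one]
  have h4 := h2.2.symm.trans h3.2
  set d := (starRingEnd ℂ) (pd j (fun z => 1 / lorShift z) z) with hdd
  have h5 : d = -(2 * lorSign j * (starRingEnd ℂ) (shiftE z j)) /
      (starRingEnd ℂ) (lorShift z) ^ 2 := by
    rw [eq_div_iff (by positivity)]
    simp only [map_div₀, map_one] at h4
    field_simp at h4
    linear_combination h4
  have h6 := (hasDbar_conj_shiftE (j := j) (z := z) j).mul h1
  simp only [map_div₀, map_one, mul_one_div, if_true] at h6
  refine h6.congr_val ?_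
  rw [h5]
  field_simp
  ring

lemma hasDbar_im_div (hz : z ∈ tube n) :
    HasDbar j (fun z => ((imP z j : ℝ) : ℂ) / ((lor (imP z) : ℝ) : ℂ))
      (I / 2 / (lor (imP z) : ℂ) -
        I * lorSign j * ((imP z j : ℝ) : ℂ) ^ 2 / (lor (imP z) : ℂ) ^ 2) z := by
  have ha : ((lor (imP z) : ℝ) : ℂ) ≠ 0 := by exact_mod_cast hz.1.ne'
  have h := (hasDbar_im (j := j) (z := z) j).mul
    ((hasDbar_lor_imP (j := j) (z := z)).comp_real (hasDerivAt_inv hz.1.ne'))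
  simp only [ofReal_inv, if_true, ← div_eq_mul_inv] at h
  refine h.congr_val ?_
  push_cast
  field_simp
  ring

end Cutoff

section CutoffWave

variable {n : ℕ} [NeZero n] {j : Fin n} {z : Fin n → ℂ}

lemma hasDbar_rpow_lor (hz : z ∈ tube n) (t : ℝ) :
    HasDbar j (fun z => ((lor (imP z) ^ t : ℝ) : ℂ))
      (((lor (imP z) ^ t : ℝ) : ℂ) *
        (t * I * lorSign j * (((imP z j : ℝ) : ℂ) / (lor (imP z) : ℂ)))) z := by
  have ha : ((lor (imP z) : ℝ) : ℂ) ≠ 0 := by exact_mod_cast hz.1.ne'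
  refine ((hasDbar_lor_imP (j := j) (z := z)).comp_real
    (Real.hasDerivAt_rpow_const (p := t) (Or.inl hz.1.ne'))).congr_val ?_
  rw [Real.rpow_sub_one hz.1.ne']
  push_cast
  field_simp

lemma hasDbar_cutoff {g g₁ : ℝ → ℝ} (hg : ∀ s, HasDerivAt g (g₁ s) s) (t : ℝ)
    (hz : z ∈ tube n) :
    HasDbar j (fun z => ((lor (imP z) ^ t * g (heightLog z) : ℝ) : ℂ))
      (((lor (imP z) ^ t : ℝ) : ℂ) * (lorSign j *
        (I * ((t * g (heightLog z) - g₁ (heightLog z) : ℝ) : ℂ) *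
          (((imP z j : ℝ) : ℂ) / (lor (imP z) : ℂ)) +
        2 * ((g₁ (heightLog z) : ℝ) : ℂ) *
          ((starRingEnd ℂ) (shiftE z j) / (starRingEnd ℂ) (lorShift z))))) z := by
  have h := (hasDbar_rpow_lor (j := j) hz t).mul
    ((hasDbar_heightLog (j := j) hz).comp_real (hg (heightLog z)))
  simp only [ofReal_mul]
  refine h.congr_val ?_
  push_cast
  ring

lemma dbar_dbar_cutoff {g g₁ g₂ : ℝ → ℝ} (hg : ∀ s, HasDerivAt g (g₁ s) s)
    (hg₁ : ∀ s, HasDerivAt g₁ (g₂ s) s) (t : ℝ) (hz : z ∈ tube n) {ψ : (Fin n → ℂ) → ℂ}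
    (hψ : ∀ w ∈ tube n, ψ w = ((lor (imP w) ^ t * g (heightLog w) : ℝ) : ℂ)) :
    lorSign j * dbar j (dbar j ψ) z = ((lor (imP z) ^ t : ℝ) : ℂ) * (
      (-t * (t * g (heightLog z) - g₁ (heightLog z)) + (t * g₁ (heightLog z) - g₂ (heightLog z)) +
        (t * g (heightLog z) - g₁ (heightLog z))) / (lor (imP z) : ℂ) ^ 2 *
          (lorSign j * ((imP z j : ℝ) : ℂ) ^ 2) +
      4 * I * (t * g₁ (heightLog z) - g₂ (heightLog z)) /
        ((lor (imP z) : ℂ) * (starRingEnd ℂ) (lorShift z)) *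
          (lorSign j * ((starRingEnd ℂ) (shiftE z j) * ((imP z j : ℝ) : ℂ))) +
      (4 * g₂ (heightLog z) - 4 * g₁ (heightLog z)) / (starRingEnd ℂ) (lorShift z) ^ 2 *
        (lorSign j * (starRingEnd ℂ) (shiftE z j) ^ 2) +
      (-(t * g (heightLog z) - g₁ (heightLog z)) / (2 * (lor (imP z) : ℂ)) +
        2 * g₁ (heightLog z) / (starRingEnd ℂ) (lorShift z))) := by
  have h1 : ∀ w ∈ tube n, dbar j ψ w =
      ((lor (imP w) ^ t : ℝ) : ℂ) * (lorSign j *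
        (I * ((t * g (heightLog w) - g₁ (heightLog w) : ℝ) : ℂ) *
          (((imP w j : ℝ) : ℂ) / (lor (imP w) : ℂ)) +
        2 * ((g₁ (heightLog w) : ℝ) : ℂ) *
          ((starRingEnd ℂ) (shiftE w j) / (starRingEnd ℂ) (lorShift w)))) := by
    intro w hw
    refine ((hasDbar_cutoff hg t hw).congr_of_eventuallyEq ?_).2
    filter_upwards [isOpen_tube.mem_nhds hw] with v hv using hψ v hv
  have hb' : (starRingEnd ℂ) (lorShift z) ≠ 0 := by simpa using lorShift_ne_zero hz
  have ha : ((lor (imP z) : ℝ) : ℂ) ≠ 0 := by exact_mod_cast hz.1.ne'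
  have hk : ∀ s, HasDerivAt (fun s => t * g s - g₁ s) (t * g₁ s - g₂ s) s :=
    fun s => ((hg s).const_mul t).sub (hg₁ s)
  have hρ := hasDbar_heightLog (j := j) hz
  have h2 := (hasDbar_rpow_lor (j := j) hz t).mul
    (((((hρ.comp_real (hk (heightLog z))).const_mul I).mul (hasDbar_im_div hz)).add
      (((hρ.comp_real (hg₁ (heightLog z))).const_mul 2).mul
        (hasDbar_conj_shiftE_div hz))).const_mul (lorSign j))
  have h3 := (h2.congr_of_eventuallyEq (v := dbar j ψ) (by
    filter_upwards [isOpen_tube.mem_nhds hz] with v hv using h1 v hv)).2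
  rw [h3]
  generalize lor (imP z) ^ t = A
  push_cast
  rcases lorSign_eq_or j with hη | hη <;> rw [hη] <;> field_simp <;> ring_nf <;>
    simp only [I_sq] <;> ring

lemma waveBar_cutoff {g g₁ g₂ : ℝ → ℝ} (hg : ∀ s, HasDerivAt g (g₁ s) s)
    (hg₁ : ∀ s, HasDerivAt g₁ (g₂ s) s) (t : ℝ) (hz : z ∈ tube n) {ψ : (Fin n → ℂ) → ℂ}
    (hψ : ∀ w ∈ tube n, ψ w = ((lor (imP w) ^ t * g (heightLog w) : ℝ) : ℂ)) :
    waveBar ψ z = ((lor (imP z) ^ (t - 1) : ℝ) : ℂ) * (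
      -(t * (t - 1 + n / 2)) * g (heightLog z) +
      (g₁ (heightLog z) * (2 * t - 1 + n / 2 +
          (2 * n - 4) * ((lor (imP z) : ℂ) / (starRingEnd ℂ) (lorShift z)) +
          4 * I * t * ((starRingEnd ℂ) (lorBilC (shiftE z) (toC (imP z))) /
            (starRingEnd ℂ) (lorShift z))) +
        g₂ (heightLog z) * (-1 + 4 * ((lor (imP z) : ℂ) / (starRingEnd ℂ) (lorShift z)) -
          4 * I * ((starRingEnd ℂ) (lorBilC (shiftE z) (toC (imP z))) /
            (starRingEnd ℂ) (lorShift z))))) := by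
  have hb' : (starRingEnd ℂ) (lorShift z) ≠ 0 := by simpa using lorShift_ne_zero hz
  have ha : ((lor (imP z) : ℝ) : ℂ) ≠ 0 := by exact_mod_cast hz.1.ne'
  rw [waveBar, two_mul_sub_sum (fun j => dbar j (dbar j ψ) z)]
  simp_rw [dbar_dbar_cutoff hg hg₁ t hz hψ]
  rw [← Finset.mul_sum]
  simp_rw [Finset.sum_add_distrib, ← Finset.mul_sum]
  rw [sum_lorSign_im, sum_lorSign_conj_shiftE_mul, sum_lorSign_conj_shiftE_sq,
    Real.rpow_sub_one hz.1.ne']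
  simp only [Finset.sum_const, Finset.card_univ, Fintype.card_fin, nsmul_eq_mul]
  push_cast
  field_simp
  ring

end CutoffWave

section Exhaustion

variable {n : ℕ} [NeZero n] {z : Fin n → ℂ}

lemma lorShift_bounds_im (hz : z ∈ tube n) :
    lor (imP z) ≤ ‖lorShift z‖ ∧ ‖lorBilC (shiftE z) (toC (imP z))‖ ≤ ‖lorShift z‖ := by
  refine lor_le_norm_lorC hz fun t ht => ?_
  have h : imP (shiftE z) + t • imP z = (1 + t) • imP z + baseE n := by
    rw [imP_shiftE]; module
  rw [h]
  exact add_mem_cone (smul_mem_cone (by linarith) hz) baseE_mem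

lemma lorShift_bounds_baseE (hz : z ∈ tube n) :
    1 ≤ ‖lorShift z‖ ∧ ‖shiftE z 0‖ ≤ ‖lorShift z‖ := by
  have h := lor_le_norm_lorC (y := baseE n) (z := shiftE z) baseE_mem fun t ht => by
    have h : imP (shiftE z) + t • baseE n = imP z + (1 + t) • baseE n := by
      rw [imP_shiftE]; module
    rw [h]
    exact add_mem_cone hz (smul_mem_cone (by linarith) baseE_mem)
  have h2 : lorBilC (shiftE z) (toC (baseE n)) = shiftE z 0 := by
    simp [lorBilC, toC, baseE, Pi.single_apply, apply_ite ofReal]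
    ring
  rwa [lor_baseE, h2] at h

/-- A compact exhaustion of the tube. -/
def exhaust (n : ℕ) [NeZero n] (M : ℝ) : Set (Fin n → ℂ) :=
  {z | 0 ≤ imP z 0 ∧ normSq (lorShift z) ≤ M * lor (imP z) ∧ 1 ≤ ‖lorShift z‖}

lemma continuous_shiftE : Continuous (shiftE : (Fin n → ℂ) → Fin n → ℂ) := by
  unfold shiftE; fun_prop

lemma continuous_lorShift : Continuous (lorShift : (Fin n → ℂ) → ℂ) :=
  continuous_lorC.comp continuous_shiftE

lemma exhaust_subset_tube {M : ℝ} (hM : 0 < M) : exhaust n M ⊆ tube n := by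
  rintro z ⟨h0, h1, h2⟩
  have h3 : 0 < normSq (lorShift z) := by
    rw [normSq_eq_norm_sq]; positivity
  have ha : 0 < lor (imP z) := by
    by_contra h
    nlinarith
  refine ⟨ha, lt_of_le_of_ne h0 fun h => ?_⟩
  have := tail_nonneg (imP z)
  unfold lor at ha
  rw [← h] at this ha
  linarith

lemma isClosed_exhaust (M : ℝ) : IsClosed (exhaust n M) :=
  (isClosed_le continuous_const ((continuous_apply 0).comp continuous_imP)).inter
    ((isClosed_le (continuous_normSq.comp continuous_lorShift)
      (continuous_const.mul (continuous_lor.comp continuous_imP))).inter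
      (isClosed_le continuous_const continuous_lorShift.norm))

lemma isCompact_exhaust {M : ℝ} (hM : 0 < M) : IsCompact (exhaust n M) := by
  refine Metric.isCompact_of_isClosed_isBounded (isClosed_exhaust M) ?_
  refine (Metric.isBounded_closedBall (x := (0 : Fin n → ℂ)) (r := 3 * M + 1)).subset fun z hz => ?_
  have hzt := exhaust_subset_tube hM hz
  obtain ⟨h0, h1, h2⟩ := hz
  obtain ⟨h3, -⟩ := lorShift_bounds_im hzt
  obtain ⟨-, h4⟩ := lorShift_bounds_baseE hzt
  have h5 : ‖lorShift z‖ ≤ M := by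
    rw [normSq_eq_norm_sq] at h1
    nlinarith
  have h6 : |(shiftE z 0).re| ≤ M := (abs_re_le_norm _).trans (h4.trans h5)
  have h7 : |(shiftE z 0).im| ≤ M := (abs_im_le_norm _).trans (h4.trans h5)
  have hre : ∀ i, (shiftE z i).re = (z i).re := by
    intro i; simp [shiftE, toC]
  have him : (shiftE z 0).im = imP z 0 + 1 := by
    simp [shiftE, toC, baseE, imP]
  rw [hre] at h6
  rw [him] at h7
  have h8 : imP z 0 ≤ M := by linarith [le_abs_self (imP z 0 + 1)]
  have h9 := lorC_re (shiftE z)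
  have h10 : reP (shiftE z) = reP z := funext hre
  have h11 : -M ≤ (lorC (shiftE z)).re :=
    (neg_le_neg ((abs_re_le_norm _).trans h5)).trans (neg_abs_le _)
  have h12 := (shiftE_mem hzt).1
  rw [h10] at h9
  have h13 : ∑ i, (reP z i) ^ 2 ≤ 2 * M ^ 2 + M := by
    have : reP z 0 ^ 2 ≤ M ^ 2 := sq_le_sq' (abs_le.1 h6).1 (abs_le.1 h6).2
    unfold lor at h9 h12
    linarith
  rw [mem_closedBall_zero_iff, pi_norm_le_iff_of_nonneg (by positivity)]
  intro i
  have h14 : |reP z i| ≤ 2 * M + 1 := by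
    refine abs_le_of_sq_le_sq ?_ (by positivity)
    have := Finset.single_le_sum (f := fun i => reP z i ^ 2) (fun j _ => sq_nonneg _)
      (Finset.mem_univ i)
    nlinarith
  have h15 : |imP z i| ≤ M := (sq_le_of_mem_cone hzt i).trans h8
  have h16 := norm_le_abs_re_add_abs_im (z i)
  unfold reP at h14
  unfold imP at h15
  linarith

lemma mem_exhaust {L : ℝ} (hz : z ∈ tube n) (h : heightLog z < L) : z ∈ exhaust n (Real.exp L) := by
  refine ⟨hz.2.le, ?_, (lorShift_bounds_baseE hz).1⟩
  have hb : 0 < normSq (lorShift z) := normSq_pos.2 (lorShift_ne_zero hz)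
  rw [← Real.log_le_log_iff hb (mul_pos (Real.exp_pos L) hz.1),
    Real.log_mul (Real.exp_pos L).ne' hz.1.ne', Real.log_exp]
  unfold heightLog at h
  linarith

lemma contDiffOn_rpow_lor (t : ℝ) :
    ContDiffOn ℝ 2 (fun z : Fin n → ℂ => lor (imP z) ^ t) (tube n) := by
  refine ContDiffOn.rpow_const_of_ne ?_ fun z hz => hz.1.ne'
  have h : ContDiff ℝ 2 (fun z : Fin n → ℂ => lor (imP z)) := by
    have hi : ∀ i : Fin n, ContDiff ℝ 2 (fun z : Fin n → ℂ => imP z i) := fun i =>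
      imCLM.contDiff.comp (contDiff_apply ℝ ℂ i)
    unfold lor
    exact (contDiff_const.mul ((hi 0).pow 2)).sub (ContDiff.sum fun i _ => (hi i).pow 2)
  exact h.contDiffOn

lemma contDiffOn_heightLog : ContDiffOn ℝ 2 (heightLog : (Fin n → ℂ) → ℝ) (tube n) := by
  have hi : ∀ i : Fin n, ContDiff ℝ 2 (fun z : Fin n → ℂ => imP z i) := fun i =>
    imCLM.contDiff.comp (contDiff_apply ℝ ℂ i)
  have hl : ContDiff ℝ 2 (fun z : Fin n → ℂ => lor (imP z)) := by
    unfold lor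
    exact (contDiff_const.mul ((hi 0).pow 2)).sub (ContDiff.sum fun i _ => (hi i).pow 2)
  have hb : ContDiff ℝ 2 (fun z : Fin n → ℂ => lorShift z) := by
    have hs : ∀ i : Fin n, ContDiff ℝ 2 (fun z : Fin n → ℂ => shiftE z i) := fun i =>
      (contDiff_apply ℝ ℂ i).add contDiff_const
    unfold lorShift lorC
    exact (contDiff_const.mul ((hs 0).pow 2)).sub (ContDiff.sum fun i _ => (hs i).pow 2)
  have hn : ContDiff ℝ 2 (fun z : Fin n → ℂ => normSq (lorShift z)) := by
    simp only [normSq_apply]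
    exact ((reCLM.contDiff.comp hb).mul (reCLM.contDiff.comp hb)).add
      ((imCLM.contDiff.comp hb).mul (imCLM.contDiff.comp hb))
  exact (hn.contDiffOn.log fun z hz => (normSq_pos.2 (lorShift_ne_zero hz)).ne').sub
    (hl.contDiffOn.log fun z hz => hz.1.ne')

open Classical in
/-- The test function `Δ(Im z)^t g(ρ(z))` on the tube, extended by zero. -/
def cutoff (n : ℕ) [NeZero n] (t : ℝ) (g : ℝ → ℝ) (z : Fin n → ℂ) : ℂ :=
  if z ∈ tube n then ((lor (imP z) ^ t * g (heightLog z) : ℝ) : ℂ) else 0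

lemma cutoff_eq_zero {t L : ℝ} {g : ℝ → ℝ} (hg : ∀ s, L ≤ s → g s = 0)
    (hz : z ∉ exhaust n (Real.exp L)) : cutoff n t g z = 0 := by
  unfold cutoff
  split_ifs with h
  · rw [hg _ (not_lt.1 fun h' => hz (mem_exhaust h h'))]
    simp
  · rfl

lemma tsupport_cutoff_subset {t L : ℝ} {g : ℝ → ℝ} (hg : ∀ s, L ≤ s → g s = 0) :
    tsupport (cutoff n t g) ⊆ exhaust n (Real.exp L) := by
  refine closure_minimal (fun z hz => ?_) (isClosed_exhaust _)
  by_contra h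
  exact hz (cutoff_eq_zero hg h)

lemma contDiff_cutoff {t L : ℝ} {g : ℝ → ℝ} (hg : ∀ s, L ≤ s → g s = 0) (hgc : ContDiff ℝ 2 g) :
    ContDiff ℝ 2 (cutoff n t g) := by
  refine contDiff_of_contDiffOn_union_of_isOpen (s := tube n) (t := (exhaust n (Real.exp L))ᶜ)
    ?_ ?_ ?_ isOpen_tube (isClosed_exhaust _).isOpen_compl
  · have h : ContDiffOn ℝ 2 (fun z : Fin n → ℂ =>
        ((lor (imP z) ^ t * g (heightLog z) : ℝ) : ℂ)) (tube n) :=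
      ofRealCLM.contDiff.comp_contDiffOn
        ((contDiffOn_rpow_lor t).mul (hgc.comp_contDiffOn contDiffOn_heightLog))
    exact h.congr fun z hz => if_pos hz
  · exact (contDiffOn_const (c := (0 : ℂ))).congr fun z hz => cutoff_eq_zero hg hz
  · rw [Set.eq_univ_iff_forall]
    intro z
    by_cases hz : z ∈ tube n
    · exact Or.inl hz
    · exact Or.inr fun h => hz (exhaust_subset_tube (Real.exp_pos L) h)

lemma exists_real_cutoff : ∃ f f₁ f₂ : ℝ → ℝ, ContDiff ℝ 2 f ∧ (∀ s, HasDerivAt f (f₁ s) s) ∧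
    (∀ s, HasDerivAt f₁ (f₂ s) s) ∧ Continuous f₂ ∧ f 0 = 1 ∧ (∀ s, 2 ≤ s → f s = 0) ∧
    ∃ C : ℝ, ∀ s, |f s| ≤ C ∧ |f₁ s| ≤ C ∧ |f₂ s| ≤ C := by
  let f : ContDiffBump (0 : ℝ) := ⟨1, 2, one_pos, one_lt_two⟩
  have hf : ContDiff ℝ 2 f := f.contDiff
  have hf1 : ContDiff ℝ 1 (deriv f) := by
    have : ContDiff ℝ (1 + 1) f := f.contDiff
    exact (contDiff_succ_iff_deriv.1 this).2.2
  have hf2 : Continuous (deriv (deriv f)) := hf1.continuous_deriv (by rfl)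
  have hc : HasCompactSupport f := f.hasCompactSupport
  obtain ⟨C0, h0⟩ := hc.exists_bound_of_continuous hf.continuous
  obtain ⟨C1, h1⟩ := hc.deriv.exists_bound_of_continuous hf1.continuous
  obtain ⟨C2, h2⟩ := hc.deriv.deriv.exists_bound_of_continuous hf2
  refine ⟨f, deriv f, deriv (deriv f), hf,
    fun s => (hf.differentiable two_ne_zero s).hasDerivAt,
    fun s => (hf1.differentiable one_ne_zero s).hasDerivAt, hf2, ?_, ?_,
    max C0 (max C1 C2), fun s => ⟨?_, ?_, ?_⟩⟩
  · exact f.one_of_mem_closedBall (by simp [f.rIn_pos.le])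
  · intro s hs
    refine f.zero_of_le_dist ?_
    rw [Real.dist_eq, sub_zero]
    exact hs.trans (le_abs_self s)
  · exact (h0 s).trans (le_max_left _ _)
  · exact (h1 s).trans ((le_max_left _ _).trans (le_max_right _ _))
  · exact (h2 s).trans ((le_max_right _ _).trans (le_max_right _ _))

end Exhaustion

section OneStep

variable {n : ℕ} [NeZero n]

lemma ae_dV_mem_tube (ν : ℝ) : ∀ᵐ z ∂(dV n ν), z ∈ tube n :=
  (withDensity_absolutelyContinuous _ _).ae_le (ae_restrict_mem isOpen_tube.measurableSet)

/-- The correction factor arising when `□̄` hits the cutoff. -/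
def cutoffError (t : ℝ) (b₁ b₂ : ℝ) (z : Fin n → ℂ) : ℂ :=
  b₁ * (2 * t - 1 + n / 2 +
      (2 * n - 4) * ((lor (imP z) : ℂ) / (starRingEnd ℂ) (lorShift z)) +
      4 * I * t * ((starRingEnd ℂ) (lorBilC (shiftE z) (toC (imP z))) /
        (starRingEnd ℂ) (lorShift z))) +
    b₂ * (-1 + 4 * ((lor (imP z) : ℂ) / (starRingEnd ℂ) (lorShift z)) -
      4 * I * ((starRingEnd ℂ) (lorBilC (shiftE z) (toC (imP z))) /
        (starRingEnd ℂ) (lorShift z)))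

lemma norm_cutoffError_le (t b₁ b₂ : ℝ) {z : Fin n → ℂ} (hz : z ∈ tube n) :
    ‖cutoffError t b₁ b₂ z‖ ≤
      |b₁| * (‖(2 * t - 1 + n / 2 : ℂ)‖ + ‖(2 * n - 4 : ℂ)‖ + ‖(4 * I * t : ℂ)‖) + |b₂| * 9 := by
  obtain ⟨h1, h2⟩ := lorShift_bounds_im hz
  have hb : 0 < ‖lorShift z‖ := norm_pos_iff.2 (lorShift_ne_zero hz)
  have e1 : ‖(lor (imP z) : ℂ) / (starRingEnd ℂ) (lorShift z)‖ ≤ 1 := by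
    rw [norm_div, norm_conj, div_le_one hb, norm_real, Real.norm_of_nonneg hz.1.le]
    exact h1
  have e2 : ‖(starRingEnd ℂ) (lorBilC (shiftE z) (toC (imP z))) /
      (starRingEnd ℂ) (lorShift z)‖ ≤ 1 := by
    rw [norm_div, norm_conj, norm_conj, div_le_one hb]
    exact h2
  unfold cutoffError
  generalize (lor (imP z) : ℂ) / (starRingEnd ℂ) (lorShift z) = A at *
  generalize (starRingEnd ℂ) (lorBilC (shiftE z) (toC (imP z))) / (starRingEnd ℂ) (lorShift z) = B
    at *
  refine (norm_add_le _ _).trans (add_le_add ?_ ?_)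
  · rw [norm_mul, norm_real, Real.norm_eq_abs]
    gcongr
    refine (norm_add₃_le).trans ?_
    rw [norm_mul _ A, norm_mul _ B]
    gcongr
    · exact mul_le_of_le_one_right (norm_nonneg _) e1
    · exact mul_le_of_le_one_right (norm_nonneg _) e2
  · rw [norm_mul, norm_real, Real.norm_eq_abs]
    gcongr
    refine (norm_sub_le _ _).trans ?_
    refine (add_le_add (norm_add_le _ _) le_rfl).trans ?_
    rw [norm_mul _ A, norm_mul _ B]
    have : ‖(4 * I : ℂ)‖ = 4 := by simp
    rw [this]
    have h4 : ‖(4 : ℂ)‖ = 4 := by simp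
    rw [h4, norm_neg, norm_one]
    linarith

lemma continuousOn_cutoffError (t : ℝ) {b₁ b₂ : (Fin n → ℂ) → ℝ}
    (h₁ : ContinuousOn b₁ (tube n)) (h₂ : ContinuousOn b₂ (tube n)) :
    ContinuousOn (fun z => cutoffError t (b₁ z) (b₂ z) z) (tube n) := by
  have hb : ContinuousOn (fun z : Fin n → ℂ => (starRingEnd ℂ) (lorShift z)) (tube n) :=
    (continuous_conj.comp continuous_lorShift).continuousOn
  have hb0 : ∀ z ∈ tube n, (starRingEnd ℂ) (lorShift z) ≠ 0 := fun z hz => by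
    simpa using lorShift_ne_zero hz
  have hA : ContinuousOn (fun z : Fin n → ℂ => (lor (imP z) : ℂ) / (starRingEnd ℂ) (lorShift z))
      (tube n) :=
    (continuous_ofReal.comp (continuous_lor.comp continuous_imP)).continuousOn.div hb hb0
  have hB : ContinuousOn (fun z : Fin n → ℂ =>
      (starRingEnd ℂ) (lorBilC (shiftE z) (toC (imP z))) / (starRingEnd ℂ) (lorShift z))
      (tube n) := by
    refine ContinuousOn.div (Continuous.continuousOn ?_) hb hb0
    unfold lorBilC toC shiftE imP
    fun_prop
  have h₁' := continuous_ofReal.comp_continuousOn h₁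
  have h₂' := continuous_ofReal.comp_continuousOn h₂
  unfold cutoffError
  exact (h₁'.mul ((continuousOn_const.add (continuousOn_const.mul hA)).add
    (continuousOn_const.mul hB))).add
    (h₂'.mul ((continuousOn_const.add (continuousOn_const.mul hA)).sub (continuousOn_const.mul hB)))

lemma integral_cutoff_identity (ν : ℝ) {F G : (Fin n → ℂ) → ℂ}
    (hF : DifferentiableOn ℂ F (tube n)) (hG : DifferentiableOn ℂ G (tube n))
    {g g₁ g₂ : ℝ → ℝ} {L : ℝ} (hgc : ContDiff ℝ 2 g) (hg : ∀ s, HasDerivAt g (g₁ s) s)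
    (hg₁ : ∀ s, HasDerivAt g₁ (g₂ s) s) (hL : ∀ s, L ≤ s → g s = 0) :
    ∫ z, F z * (starRingEnd ℂ) (BoxOp G z) * (lor (imP z) : ℂ) * g (heightLog z) ∂(dV n ν) =
      ∫ z, F z * (starRingEnd ℂ) (G z) * (((ν - n / 2 + 1) * ν : ℝ) * g (heightLog z) -
        cutoffError (ν - n / 2 + 1) (g₁ (heightLog z)) (g₂ (heightLog z)) z) ∂(dV n ν) := by
  set t : ℝ := ν - n / 2 + 1 with ht
  have hs : tsupport (cutoff n t g) ⊆ tube n :=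
    (tsupport_cutoff_subset hL).trans (exhaust_subset_tube (Real.exp_pos L))
  have hc : HasCompactSupport (cutoff n t g) :=
    (isCompact_exhaust (Real.exp_pos L)).of_isClosed_subset (isClosed_tsupport _)
      (tsupport_cutoff_subset hL)
  have h := integral_mul_conj_BoxOp_mul isOpen_tube hF hG (contDiff_cutoff (t := t) hL hgc) hc hs
  have hval : ∀ w ∈ tube n, cutoff n t g w = ((lor (imP w) ^ t * g (heightLog w) : ℝ) : ℂ) :=
    fun w hw => if_pos hw
  have hout : ∀ w, w ∉ tube n → w ∉ tsupport (cutoff n t g) := fun w hw h => hw (hs h)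
  rw [integral_dV, integral_dV]
  rw [← setIntegral_eq_integral_of_forall_compl_eq_zero (s := tube n) fun z hz => by
      rw [image_eq_zero_of_notMem_tsupport (hout z hz), mul_zero],
    ← setIntegral_eq_integral_of_forall_compl_eq_zero (s := tube n)
      (f := fun z => F z * (starRingEnd ℂ) (G z) * waveBar (cutoff n t g) z) fun z hz => by
      have h0 : ∀ j, dbar j (dbar j (cutoff n t g)) z = 0 := fun j =>
        dbar_eq_zero_of_notMem (fun h => hout z hz (tsupport_dbar_subset _ j h)) j
      simp [waveBar, h0], ← integral_neg] at h
  have hm : MeasurableSet (tube n) := isOpen_tube.measurableSet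
  refine Eq.trans (setIntegral_congr_fun hm fun z hz => ?_)
    (h.trans (setIntegral_congr_fun hm fun z hz => ?_))
  · rw [hval z hz, ht, Real.rpow_add_one hz.1.ne']
    push_cast
    ring
  · rw [waveBar_cutoff hg hg₁ t hz hval, cutoffError, ht]
    rw [show ν - (n : ℝ) / 2 + 1 - 1 = ν - n / 2 by ring]
    push_cast
    ring

/-- The one-step integration by parts formula. -/
theorem integral_mul_conj_BoxOp (ν : ℝ) {F G : (Fin n → ℂ) → ℂ}
    (hF : DifferentiableOn ℂ F (tube n)) (hG : DifferentiableOn ℂ G (tube n))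
    (hI₀ : Integrable (fun z => F z * (starRingEnd ℂ) (G z)) (dV n ν))
    (hI₁ : Integrable (fun z => F z * (starRingEnd ℂ) (BoxOp G z) * (lor (imP z) : ℂ)) (dV n ν)) :
    ∫ z, F z * (starRingEnd ℂ) (BoxOp G z) * (lor (imP z) : ℂ) ∂(dV n ν) =
      (((ν - n / 2 + 1) * ν : ℝ) : ℂ) * ∫ z, F z * (starRingEnd ℂ) (G z) ∂(dV n ν) := by
  obtain ⟨f, f₁, f₂, hfc, hf, hf₁, hf₂c, hf0, hf2, C, hC⟩ := exists_real_cutoff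
  set t : ℝ := ν - n / 2 + 1 with ht
  set c : ℝ := t * ν with hcdef
  have hC0 : 0 ≤ C := (abs_nonneg _).trans (hC 0).1
  have hf₁c : Continuous f₁ := continuous_iff_continuousAt.2 fun s => (hf₁ s).continuousAt
  have hHc : ContinuousOn (heightLog : (Fin n → ℂ) → ℝ) (tube n) := contDiffOn_heightLog.continuousOn
  have hpos : ∀ k : ℕ, (0 : ℝ) < (k : ℝ) + 1 := fun k => by positivity
  have hid : ∀ k : ℕ,
      ∫ z, F z * (starRingEnd ℂ) (BoxOp G z) * (lor (imP z) : ℂ) *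
        f (heightLog z / (k + 1)) ∂(dV n ν) =
      ∫ z, F z * (starRingEnd ℂ) (G z) * (c * f (heightLog z / (k + 1)) -
        cutoffError t (f₁ (heightLog z / (k + 1)) / (k + 1))
          (f₂ (heightLog z / (k + 1)) / (k + 1) / (k + 1)) z) ∂(dV n ν) := by
    intro k
    refine integral_cutoff_identity ν hF hG (g := fun s => f (s / (k + 1)))
      (g₁ := fun s => f₁ (s / (k + 1)) / (k + 1))
      (g₂ := fun s => f₂ (s / (k + 1)) / (k + 1) / (k + 1)) (L := 2 * (k + 1)) ?_ ?_ ?_ ?_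
    · exact hfc.comp (contDiff_id.div_const _)
    · intro s
      have := (hf (s / (k + 1))).comp s ((hasDerivAt_id s).div_const ((k : ℝ) + 1))
      refine this.congr_deriv ?_
      ring
    · intro s
      have := ((hf₁ (s / (k + 1))).comp s ((hasDerivAt_id s).div_const ((k : ℝ) + 1))).div_const
        ((k : ℝ) + 1)
      refine this.congr_deriv ?_
      ring
    · intro s hs
      exact hf2 _ ((le_div_iff₀ (hpos k)).2 hs)
  have hlim : ∀ z : Fin n → ℂ, Filter.Tendsto (fun k : ℕ => heightLog z / ((k : ℝ) + 1))
      Filter.atTop (nhds 0) := fun z =>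
    tendsto_const_nhds.div_atTop
      (Filter.tendsto_atTop_add_const_right _ _ tendsto_natCast_atTop_atTop)
  have hflim : ∀ z : Fin n → ℂ, Filter.Tendsto (fun k : ℕ => ((f (heightLog z / ((k : ℝ) + 1)) : ℝ) : ℂ))
      Filter.atTop (nhds 1) := fun z => by
    have := (continuous_ofReal.tendsto _).comp ((hfc.continuous.tendsto 0).comp (hlim z))
    simpa [hf0, Function.comp_def] using this
  have hHk : ∀ k : ℕ, ContinuousOn (fun z : Fin n → ℂ => heightLog z / ((k : ℝ) + 1)) (tube n) :=
    fun k => hHc.div_const _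
  have hGc : ContinuousOn (fun z => F z * (starRingEnd ℂ) (G z)) (tube n) :=
    hF.continuousOn.mul (continuous_conj.comp_continuousOn hG.continuousOn)
  have hBc : ContinuousOn (fun z => F z * (starRingEnd ℂ) (BoxOp G z) * (lor (imP z) : ℂ))
      (tube n) :=
    (hF.continuousOn.mul (continuous_conj.comp_continuousOn
      (differentiableOn_BoxOp isOpen_tube hG).continuousOn)).mul
      (continuous_ofReal.comp (continuous_lor.comp continuous_imP)).continuousOn
  set S : ℝ := ‖(2 * t - 1 + n / 2 : ℂ)‖ + ‖(2 * n - 4 : ℂ)‖ + ‖(4 * I * t : ℂ)‖ with hS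
  have herr : ∀ k : ℕ, ∀ z ∈ tube n,
      ‖cutoffError t (f₁ (heightLog z / (k + 1)) / (k + 1))
          (f₂ (heightLog z / (k + 1)) / (k + 1) / (k + 1)) z‖ ≤ (C * S + C * 9) / ((k : ℝ) + 1) := by
    intro k z hz
    refine (norm_cutoffError_le t _ _ hz).trans ?_
    have h1 := (hC (heightLog z / (k + 1))).2.1
    have h2 := (hC (heightLog z / (k + 1))).2.2
    have hk1 : (1 : ℝ) ≤ (k : ℝ) + 1 := by simp
    rw [abs_div, abs_div, abs_div, abs_of_pos (hpos k), add_div, div_mul_eq_mul_div,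
      div_mul_eq_mul_div]
    refine add_le_add (by gcongr) ?_
    have h3 : |f₂ (heightLog z / (k + 1))| / ((k : ℝ) + 1) ≤ C :=
      (div_le_self (abs_nonneg _) hk1).trans h2
    gcongr
  have hT1 : Filter.Tendsto (fun k : ℕ => ∫ z, F z * (starRingEnd ℂ) (BoxOp G z) *
      (lor (imP z) : ℂ) * f (heightLog z / (k + 1)) ∂(dV n ν)) Filter.atTop
      (nhds (∫ z, F z * (starRingEnd ℂ) (BoxOp G z) * (lor (imP z) : ℂ) ∂(dV n ν))) := by
    refine tendsto_integral_of_dominated_convergence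
      (fun z => ‖F z * (starRingEnd ℂ) (BoxOp G z) * (lor (imP z) : ℂ)‖ * C) (fun k => ?_)
      (hI₁.norm.mul_const C) (fun k => ?_) ?_
    · exact aestronglyMeasurable_dV (hBc.mul (continuous_ofReal.comp_continuousOn
        (hfc.continuous.comp_continuousOn (hHk k)))) ν
    · refine Filter.Eventually.of_forall fun z => ?_
      rw [norm_mul, norm_real]
      gcongr
      exact (hC _).1
    · refine Filter.Eventually.of_forall fun z => ?_
      simpa using (hflim z).const_mul (F z * (starRingEnd ℂ) (BoxOp G z) * (lor (imP z) : ℂ))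
  have hT2 : Filter.Tendsto (fun k : ℕ => ∫ z, F z * (starRingEnd ℂ) (G z) *
      (c * f (heightLog z / (k + 1)) -
        cutoffError t (f₁ (heightLog z / (k + 1)) / (k + 1))
          (f₂ (heightLog z / (k + 1)) / (k + 1) / (k + 1)) z) ∂(dV n ν)) Filter.atTop
      (nhds (∫ z, F z * (starRingEnd ℂ) (G z) * c ∂(dV n ν))) := by
    refine tendsto_integral_of_dominated_convergence
      (fun z => ‖F z * (starRingEnd ℂ) (G z)‖ * (|c| * C + (C * S + C * 9))) (fun k => ?_)
      (hI₀.norm.mul_const _) (fun k => ?_) ?_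
    · refine aestronglyMeasurable_dV (hGc.mul ((continuousOn_const.mul
        (continuous_ofReal.comp_continuousOn
        (hfc.continuous.comp_continuousOn (hHk k)))).sub (continuousOn_cutoffError t ?_ ?_))) ν
      · exact (hf₁c.comp_continuousOn (hHk k)).div_const _
      · exact ((hf₂c.comp_continuousOn (hHk k)).div_const _).div_const _
    · filter_upwards [ae_dV_mem_tube ν] with z hz
      rw [norm_mul]
      gcongr
      refine (norm_sub_le _ _).trans (add_le_add ?_ ((herr k z hz).trans ?_))
      · rw [norm_mul, norm_real, norm_real]
        exact mul_le_mul_of_nonneg_left (hC _).1 (abs_nonneg c)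
      · exact div_le_self (by positivity) (by simp)
    · filter_upwards [ae_dV_mem_tube ν] with z hz
      have h0 : Filter.Tendsto (fun k : ℕ =>
          cutoffError t (f₁ (heightLog z / (k + 1)) / (k + 1))
          (f₂ (heightLog z / (k + 1)) / (k + 1) / (k + 1)) z) Filter.atTop (nhds 0) :=
        squeeze_zero_norm (fun k => herr k z hz) (tendsto_const_nhds.div_atTop
          (Filter.tendsto_atTop_add_const_right _ _ tendsto_natCast_atTop_atTop))
      simpa using (((hflim z).const_mul (c : ℂ)).sub h0).const_mul (F z * (starRingEnd ℂ) (G z))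
  simp_rw [hid] at hT1
  have h := tendsto_nhds_unique hT1 hT2
  rw [h, integral_mul_const, mul_comm]

end OneStep

section Iteration

variable {n : ℕ} [NeZero n]

lemma weight_mul_pow (ν : ℝ) (k : ℕ) (f : (Fin n → ℂ) → ℂ) {z : Fin n → ℂ} (hz : z ∈ tube n) :
    ((lor (imP z) ^ (ν - (n : ℝ) / 2) : ℝ) : ℂ) * (f z * (lor (imP z) : ℂ) ^ k) =
      ((lor (imP z) ^ (ν + k - (n : ℝ) / 2) : ℝ) : ℂ) * f z := by
  rw [show ν + k - (n : ℝ) / 2 = ν - n / 2 + k by ring, Real.rpow_add hz.1, Real.rpow_natCast]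
  push_cast
  ring

lemma integral_mul_pow_dV (ν : ℝ) (k : ℕ) (f : (Fin n → ℂ) → ℂ) :
    ∫ z, f z * (lor (imP z) : ℂ) ^ k ∂(dV n ν) = ∫ z, f z ∂(dV n (ν + k)) := by
  rw [integral_dV, integral_dV]
  exact setIntegral_congr_fun isOpen_tube.measurableSet fun z hz => weight_mul_pow ν k f hz

lemma integrable_mul_pow_dV_iff (ν : ℝ) (k : ℕ) (f : (Fin n → ℂ) → ℂ) :
    Integrable (fun z => f z * (lor (imP z) : ℂ) ^ k) (dV n ν) ↔
      Integrable f (dV n (ν + k)) := by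
  rw [integrable_dV_iff, integrable_dV_iff]
  exact integrableOn_congr_fun (fun z hz => weight_mul_pow ν k f hz) isOpen_tube.measurableSet

lemma integral_mul_conj_BoxOp_iterate_succ (ν : ℝ) {F G : (Fin n → ℂ) → ℂ}
    (hF : DifferentiableOn ℂ F (tube n)) (hG : DifferentiableOn ℂ G (tube n))
    (hI : ∀ k : ℕ, Integrable
      (fun z => F z * (starRingEnd ℂ) (BoxOp^[k] G z) * ((lor (imP z) : ℂ)) ^ k) (dV n ν))
    (k : ℕ) :
    ∫ z, F z * (starRingEnd ℂ) (BoxOp^[k + 1] G z) * ((lor (imP z) : ℂ)) ^ (k + 1) ∂(dV n ν) =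
      (((ν + k - n / 2 + 1) * (ν + k) : ℝ) : ℂ) *
        ∫ z, F z * (starRingEnd ℂ) (BoxOp^[k] G z) * ((lor (imP z) : ℂ)) ^ k ∂(dV n ν) := by
  have e : ∀ z : Fin n → ℂ,
      F z * (starRingEnd ℂ) (BoxOp^[k + 1] G z) * ((lor (imP z) : ℂ)) ^ (k + 1) =
      F z * (starRingEnd ℂ) (BoxOp (BoxOp^[k] G) z) * (lor (imP z) : ℂ) *
        (lor (imP z) : ℂ) ^ k := by
    intro z
    rw [Function.iterate_succ_apply']
    ring
  have h0 := hI k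
  have h1 := hI (k + 1)
  simp_rw [e] at h1 ⊢
  rw [integrable_mul_pow_dV_iff] at h0 h1
  rw [integral_mul_pow_dV, integral_mul_pow_dV]
  exact integral_mul_conj_BoxOp (ν + k) hF (differentiableOn_BoxOp_iterate isOpen_tube hG k) h0 h1

lemma integral_mul_conj_BoxOp_iterate (ν : ℝ) {F G : (Fin n → ℂ) → ℂ}
    (hF : DifferentiableOn ℂ F (tube n)) (hG : DifferentiableOn ℂ G (tube n))
    (hI : ∀ k : ℕ, Integrable
      (fun z => F z * (starRingEnd ℂ) (BoxOp^[k] G z) * ((lor (imP z) : ℂ)) ^ k) (dV n ν))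
    (m : ℕ) :
    ∫ z, F z * (starRingEnd ℂ) (BoxOp^[m] G z) * ((lor (imP z) : ℂ)) ^ m ∂(dV n ν) =
      (∏ k ∈ Finset.range m, (((ν + k - n / 2 + 1) * (ν + k) : ℝ) : ℂ)) *
        ∫ z, F z * (starRingEnd ℂ) (G z) ∂(dV n ν) := by
  induction m with
  | zero => simp
  | succ m ih =>
    rw [integral_mul_conj_BoxOp_iterate_succ ν hF hG hI, ih, Finset.prod_range_succ]
    ring

end Iteration

/-- integration by parts: `∫ F conj G dV_ν = c_{ν,m} ∫ F conj(□^m G) Δ(Im z)^m dV_ν`. -/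
theorem integration_by_parts (n : ℕ) [NeZero n] (hn : 3 ≤ n) (ν p : ℝ)
    (hν : (n : ℝ) / 2 - 1 < ν) (hp : 1 ≤ p) (m : ℕ) (hm : 1 ≤ m) :
    ∃ c : ℂ, ∀ F G : (Fin n → ℂ) → ℂ, memA n p ν F →
      (if p = 1 then DifferentiableOn ℂ G (tube n) ∧ ∃ M : ℝ, ∀ z ∈ tube n, ‖G z‖ ≤ M
       else memA n (p / (p - 1)) ν G) →
      Integrable (fun z => F z * (starRingEnd ℂ) (G z)) (dV n ν) ∧
      Integrable (fun z => F z * (starRingEnd ℂ) (BoxOp^[m] G z) * ((lor (imP z) : ℂ)) ^ m)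
        (dV n ν) ∧
      ∫ z, F z * (starRingEnd ℂ) (G z) ∂(dV n ν) =
        c * ∫ z, F z * (starRingEnd ℂ) (BoxOp^[m] G z) * ((lor (imP z) : ℂ)) ^ m ∂(dV n ν) := by
  refine ⟨(∏ k ∈ Finset.range m, (((ν + k - n / 2 + 1) * (ν + k) : ℝ) : ℂ))⁻¹,
    fun F G hF hG => ?_⟩
  have hI := integrable_mul_conj_BoxOp_iterate hp hF hG
  have hGd : DifferentiableOn ℂ G (tube n) := by
    split_ifs at hG
    exacts [hG.1, hG.1]
  refine ⟨by simpa using hI 0, hI m, ?_⟩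
  rw [integral_mul_conj_BoxOp_iterate ν hF.1 hGd hI m, inv_mul_cancel_left₀]
  refine Finset.prod_ne_zero_iff.2 fun k _ => ?_
  have hn' : (3 : ℝ) ≤ n := by exact_mod_cast hn
  have hk : (0 : ℝ) ≤ k := k.cast_nonneg
  exact_mod_cast (mul_pos (by linarith) (by linarith) :
    0 < (ν + k - (n : ℝ) / 2 + 1) * (ν + k)).ne'
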